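/- Let S be a countable set and let X = (X_0, X_1, …) be a transient partially exchangeable process taking values in S with non-random initial state X_0. Then the partially exchangeable sigma-algebra is generated up to null sets (with respect to the law of X) by the transition numbers M = (M(u,v))_{u,v∈S}, where M(u,v) = #{i ≥ 0 : (X_i, X_{i+1}) = (u,v)}; that is, for every partially exchangeable Borel set A ⊆ S^ℕ there is an event measurable with respect to the sigma-algebra generated by M that agrees with {X ∈ A} up to a null set. -/

import Mathlib

open MeasureTheory Filter Set
open scoped ENNReal

namespace DF

/-! ### Sequences over a countable state space -/

variable {S : Type}

/-- The number of transitions from `u` to `v` among the first `n` steps of the sequence `x`. -/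
noncomputable def transCount (x : ℕ → S) (n : ℕ) (u v : S) : ℕ :=
  Set.ncard {i : ℕ | i < n ∧ x i = u ∧ x (i + 1) = v}

/-- The equivalence `(x₀,…,xₙ) ≃ (y₀,…,yₙ)` of finite sequences: same initial state and the same
transition counts between every ordered pair of states. -/
def FinEquiv (x y : ℕ → S) (n : ℕ) : Prop :=
  x 0 = y 0 ∧ ∀ u v : S, transCount x n u v = transCount y n u v

/-- The equivalence `x ≃ y` of infinite sequences: they eventually agree and their initial
segments up to that point are `≃`-equivalent. -/
def InfEquiv (x y : ℕ → S) : Prop :=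
  ∃ N : ℕ, (∀ n : ℕ, N ≤ n → x n = y n) ∧ FinEquiv x y N

/-- The transition numbers `M(u,v) = #{i ≥ 0 : (xᵢ, xᵢ₊₁) = (u,v)}` of an infinite sequence. -/
noncomputable def transNum (x : ℕ → S) (u v : S) : ℕ∞ :=
  Set.encard {i : ℕ | x i = u ∧ x (i + 1) = v}

/-- The sigma-algebra on `S^ℕ` generated by the transition numbers. -/
noncomputable def transSigma (S : Type) : MeasurableSpace (ℕ → S) :=
  ⨆ u : S, ⨆ v : S, MeasurableSpace.comap (fun x => transNum x u v) (⊤ : MeasurableSpace ℕ∞)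

/-- The tail sigma-algebra `⋂ₙ σ(Xₙ, Xₙ₊₁, …)` on `S^ℕ`. -/
def tailSigma (S : Type) [MeasurableSpace S] : MeasurableSpace (ℕ → S) :=
  ⨅ n : ℕ, MeasurableSpace.comap (fun (x : ℕ → S) (i : ℕ) => x (i + n))
    (inferInstance : MeasurableSpace (ℕ → S))

/-- A measure on `S^ℕ` is partially exchangeable if any two `≃`-equivalent finite initial
segments have the same probability. -/
def PartiallyExchangeable [MeasurableSpace S] (μ : Measure (ℕ → S)) : Prop :=
  ∀ (n : ℕ) (x y : ℕ → S), FinEquiv x y n →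
    μ {ω | ∀ i ≤ n, ω i = x i} = μ {ω | ∀ i ≤ n, ω i = y i}

/-- The set of partially exchangeable probability measures on `S^ℕ`. -/
def PEProb (S : Type) [MeasurableSpace S] : Set (Measure (ℕ → S)) :=
  {μ | μ Set.univ = 1 ∧ PartiallyExchangeable μ}

/-- `μ` is an extreme point of the convex set of partially exchangeable probability measures. -/
def IsExtremePE [MeasurableSpace S] (μ : Measure (ℕ → S)) : Prop :=
  μ ∈ PEProb S ∧
    ∀ μ₁ ∈ PEProb S, ∀ μ₂ ∈ PEProb S, ∀ t : ℝ≥0∞, 0 < t → t < 1 →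
      μ = t • μ₁ + (1 - t) • μ₂ → μ₁ = μ₂

/-! ### Digraphs -/

/-- A digraph on vertex set `V` with edge set `E`: each edge has a tail (`src`) and head (`dst`).
Multiple edges and loops are allowed. -/
structure DigraphStruct (V E : Type) where
  src : E → V
  dst : E → V

namespace DigraphStruct

variable {V E : Type} (G : DigraphStruct V E)

def outEdges (v : V) : Set E := {e | G.src e = v}

def inEdges (v : V) : Set E := {e | G.dst e = v}

noncomputable def outDeg (v : V) : ℕ := (G.outEdges v).ncard

noncomputable def inDeg (v : V) : ℕ := (G.inEdges v).ncard

def LocallyFinite : Prop := ∀ v : V, (G.outEdges v).Finite ∧ (G.inEdges v).Finite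

/-- Adjacency in the underlying undirected graph. -/
def undirAdj (u v : V) : Prop :=
  ∃ e : E, (G.src e = u ∧ G.dst e = v) ∨ (G.src e = v ∧ G.dst e = u)

/-- `G` is connected as an undirected graph. -/
def Connected : Prop := ∀ u v : V, Relation.ReflTransGen G.undirAdj u v

def dirAdj (u v : V) : Prop := ∃ e : E, G.src e = u ∧ G.dst e = v

/-- One step along an edge of the edge set `B`. -/
def step (B : Set E) (u v : V) : Prop := ∃ e ∈ B, G.src e = u ∧ G.dst e = v

/-- `(G,o)` is an infinite sourced Eulerian digraph (with sink at infinity). -/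
structure IsSourcedEulerian (o : V) : Prop where
  infinite : Infinite V
  locFin : G.LocallyFinite
  conn : G.Connected
  balanced : ∀ v : V, v ≠ o → G.inDeg v = G.outDeg v
  source : G.outDeg o = G.inDeg o + 1

/-- The reversal of `G`: head and tail of every edge are exchanged. -/
def rev : DigraphStruct V E := ⟨G.dst, G.src⟩

/-- One-step transition probability of the random walk on `G`. -/
noncomputable def stepProb (u v : V) : ℝ≥0∞ :=
  ({e : E | G.src e = u ∧ G.dst e = v}.ncard : ℝ≥0∞) / (G.outDeg u : ℝ≥0∞)

open Classical in
/-- `μ` is the law of the random walk on `G` started at `o`, characterised through its cylinder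
probabilities. -/
def IsWalkLaw [MeasurableSpace V] (o : V) (μ : Measure (ℕ → V)) : Prop :=
  μ Set.univ = 1 ∧
    ∀ (n : ℕ) (x : ℕ → V),
      μ {ω | ∀ i ≤ n, ω i = x i} =
        if x 0 = o then ∏ i ∈ Finset.range n, G.stepProb (x i) (x (i + 1)) else 0

/-- `G` is transient: from every starting point, the random walk on `G` visits every vertex at
most finitely often almost surely. -/
def TransientDigraph [MeasurableSpace V] : Prop :=
  ∀ (o : V) (μ : Measure (ℕ → V)),
    G.IsWalkLaw o μ → μ {ω | ∀ v : V, {i : ℕ | ω i = v}.Finite} = 1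

/-- An infinite path in `G` indexed by `ℕ`, encoded by its sequence of edges. -/
def IsInfPath (γ : ℕ → E) : Prop := ∀ i : ℕ, G.dst (γ i) = G.src (γ (i + 1))

/-- A transient path: it visits every vertex at most finitely often. -/
def IsTransientPath (γ : ℕ → E) : Prop := ∀ v : V, {i : ℕ | G.src (γ i) = v}.Finite

/-- The edge set of the last-exit arboretum `𝓛(γ)`: the edges crossed by `γ` as it exits their
tail for the last time. -/
def lastExitSet (γ : ℕ → E) : Set E :=
  {e | ∃ i : ℕ, γ i = e ∧ ∀ j : ℕ, i < j → G.src (γ j) ≠ G.src (γ i)}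

end DigraphStruct

/-! ### Finite paths, Eulerian paths, arborescences -/

/-- `IsPathList G o z P` means that the list of edges `P` forms a directed path from `o`
to `z` in `G`. -/
def IsPathList {V E : Type} (G : DigraphStruct V E) : V → V → List E → Prop
  | o, z, [] => o = z
  | o, z, e :: es => G.src e = o ∧ IsPathList G (G.dst e) z es

/-- `P` is an Eulerian path from `o` to `z`: a path crossing every edge exactly once. -/
def IsEulerList {V E : Type} (G : DigraphStruct V E) (o z : V) (P : List E) : Prop :=
  IsPathList G o z P ∧ P.Nodup ∧ ∀ e : E, e ∈ P

/-- `B` is (the edge set of) a spanning in-arborescence of `G` rooted at `z`. -/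
def IsFinArb {V E : Type} (G : DigraphStruct V E) (z : V) (B : Set E) : Prop :=
  (∀ e ∈ B, G.src e ≠ z) ∧
  (∀ v : V, v ≠ z → ∃! e : E, e ∈ B ∧ G.src e = v) ∧
  (∀ v : V, Relation.ReflTransGen (G.step B) v z)

/-- `(G,o,z)` is a finite Eulerian digraph with source `o` and sink `z`. -/
structure IsFinEulerian {V E : Type} (G : DigraphStruct V E) (o z : V) : Prop where
  finV : Finite V
  finE : Finite E
  reach_from : ∀ v : V, Relation.ReflTransGen G.dirAdj o v
  reach_to : ∀ v : V, Relation.ReflTransGen G.dirAdj v z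
  bal_ne : o ≠ z → (∀ v : V, v ≠ o → v ≠ z → G.inDeg v = G.outDeg v) ∧
      G.outDeg o = G.inDeg o + 1 ∧ G.inDeg z = G.outDeg z + 1
  bal_eq : o = z → ∀ v : V, G.inDeg v = G.outDeg v

/-! ### Wired uniform spanning in-arborescences -/

/-- An exhaustion of the vertex set by finite subsets. -/
def IsExhaustion {V : Type} (Vn : ℕ → Set V) : Prop :=
  (∀ n, (Vn n).Finite) ∧ (∀ n, Vn n ⊆ Vn (n + 1)) ∧ (⋃ n, Vn n) = Set.univ

/-- `B` is (the edge set of) a spanning in-arborescence of the wired graph `G_U^*`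
(all vertices outside `U` identified to a single boundary vertex) rooted at the boundary. -/
def IsWiredArb {V E : Type} (G : DigraphStruct V E) (U : Set V) (B : Set E) : Prop :=
  (∀ e ∈ B, G.src e ∈ U) ∧ (∀ v ∈ U, ∃! e : E, e ∈ B ∧ G.src e = v) ∧
  (∀ v ∈ U, ∃ v' : V, v' ∉ U ∧ Relation.ReflTransGen (G.step B) v v')

/-- The probability, under the uniform spanning in-arborescence of the wired graph `G_U^*`
rooted at the boundary, that all edges of `F` are present. -/
noncomputable def wiredUACyl {V E : Type} (G : DigraphStruct V E) (U : Set V) (F : Finset E) :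
    ℝ≥0∞ :=
  (Nat.card {B : Set E // IsWiredArb G U B ∧ (F : Set E) ⊆ B} : ℝ≥0∞) /
    (Nat.card {B : Set E // IsWiredArb G U B} : ℝ≥0∞)

/-- `κ` is the law of the wired uniform spanning in-arboretum of `G` (as a random edge set,
encoded as an element of `E → Bool`): its cylinder probabilities are the limits along any
exhaustion of the uniform spanning in-arborescence measures of the wired graphs. -/
def IsWUALaw {V E : Type} (G : DigraphStruct V E) (κ : Measure (E → Bool)) : Prop :=
  κ Set.univ = 1 ∧
    ∀ Vn : ℕ → Set V, IsExhaustion Vn → ∀ F : Finset E,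
      Filter.Tendsto (fun n => wiredUACyl G (Vn n) F) Filter.atTop
        (nhds (κ {A | ∀ e ∈ F, A e = true}))

/-- A spanning in-arboretum rooted at infinity all of whose components are one-ended:
every vertex has out-degree exactly one, and the past of every vertex is finite. -/
def IsOneEndedSpanningArb {V E : Type} (G : DigraphStruct V E) (A : Set E) : Prop :=
  (∀ v : V, ∃! e : E, e ∈ A ∧ G.src e = v) ∧
    ∀ v : V, {u : V | Relation.ReflTransGen (G.step A) u v}.Finite

/-! ### Proper Gibbs measures on Eulerian paths -/

/-- `w` is a finite path in `G` starting at `o` (encoded by its edges). -/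
def PrefixPath {V E : Type} (G : DigraphStruct V E) (o : V) {n : ℕ} (w : Fin n → E) : Prop :=
  (∀ h : 0 < n, G.src (w ⟨0, h⟩) = o) ∧
    ∀ (i : ℕ) (h : i + 1 < n), G.dst (w ⟨i, Nat.lt_of_succ_lt h⟩) = G.src (w ⟨i + 1, h⟩)

/-- A proper Gibbs measure on Eulerian paths from `o` to `∞` in `G`: a probability measure on
edge sequences, supported on half-infinite paths started at `o` crossing every edge exactly once,
such that conditionally on the steps after time `n` the first `n` steps are a uniform Eulerian
path (from `o`, in the digraph spanned by the edges not crossed after time `n`, to the position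
at time `n`). Uniformity is expressed by invariance under replacing the first `n` steps by any
other path from `o` crossing the same set of edges. -/
def ProperGibbs {V E : Type} [MeasurableSpace E] (G : DigraphStruct V E) (o : V)
    (μ : Measure (ℕ → E)) : Prop :=
  μ Set.univ = 1 ∧
  μ {γ | (∀ i : ℕ, G.dst (γ i) = G.src (γ (i + 1))) ∧ G.src (γ 0) = o ∧ Function.Bijective γ}
      = 1 ∧
  ∀ (n : ℕ) (w w' : Fin n → E), Function.Injective w → Function.Injective w' →
    Set.range w = Set.range w' → PrefixPath G o w → PrefixPath G o w' →
    ∀ B : Set (ℕ → E),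
      μ {γ | (∀ i : Fin n, γ (i : ℕ) = w i) ∧ (fun t : ℕ => γ (n + t)) ∈ B} =
        μ {γ | (∀ i : Fin n, γ (i : ℕ) = w' i) ∧ (fun t : ℕ => γ (n + t)) ∈ B}

/-! ### Loop erasure and Wilson's algorithm rooted at infinity -/

/-- The loop-erasure times of the (transient) vertex sequence `p`:
`t₀ = 0`, `tᵢ₊₁ = 1 + max {t ≥ tᵢ : p t = p tᵢ}`. -/
noncomputable def leTimes {V : Type} (p : ℕ → V) : ℕ → ℕ
  | 0 => 0
  | i + 1 => sSup {t : ℕ | leTimes p i ≤ t ∧ p t = p (leTimes p i)} + 1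

/-- The loop-erasure times of the vertex sequence `p` run up to time `k`. -/
noncomputable def leTimesF {V : Type} (p : ℕ → V) (k : ℕ) : ℕ → ℕ
  | 0 => 0
  | i + 1 => sSup {t : ℕ | leTimesF p k i ≤ t ∧ t ≤ k ∧ p t = p (leTimesF p k i)} + 1

/-- The set of vertices incident to an edge of `A`. -/
def vertsOf {V E : Type} (G : DigraphStruct V E) (A : Set E) : Set V :=
  {u | ∃ e ∈ A, G.src e = u ∨ G.dst e = u}

open Classical in
/-- The set of edges of the loop-erasure of the walk `x` (an edge sequence) stopped when it
first hits `U`; if it never hits `U`, the loop-erasure of the whole (transient) walk. -/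
noncomputable def stoppedLEedges {V E : Type} (G : DigraphStruct V E) (U : Set V) (x : ℕ → E) :
    Set E :=
  if ∃ t : ℕ, G.src (x t) ∈ U then
    {e | ∃ i : ℕ,
      leTimesF (fun t => G.src (x t)) (sInf {t : ℕ | G.src (x t) ∈ U}) i <
          sInf {t : ℕ | G.src (x t) ∈ U} ∧
        x (leTimesF (fun t => G.src (x t)) (sInf {t : ℕ | G.src (x t) ∈ U}) i) = e}
  else Set.range fun i => x (leTimes (fun t => G.src (x t)) i)

/-- The partial edge sets generated by Wilson's algorithm rooted at infinity, run with the
enumeration `v` of the vertices and with `W j` the random walk used at stage `j + 1`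
(started at `v j`). -/
noncomputable def wilsonA {V E : Type} (G : DigraphStruct V E) (v : ℕ → V) (W : ℕ → ℕ → E) :
    ℕ → Set E
  | 0 => ∅
  | j + 1 =>
      wilsonA G v W j ∪
        stoppedLEedges G (vertsOf G (wilsonA G v W j) ∪ {u | ∃ i < j, v i = u}) (W j)

open Classical in
/-- Cylinder probabilities for the random walk on `G` started at `v`, recorded as a sequence of
edges: the probability that the first `n` crossed edges are `x 0, …, x (n-1)`. -/
noncomputable def edgeWalkCyl {V E : Type} (G : DigraphStruct V E) (v : V) (x : ℕ → E) (n : ℕ) :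
    ℝ≥0∞ :=
  if (0 < n → G.src (x 0) = v) ∧ (∀ i : ℕ, i + 1 < n → G.dst (x i) = G.src (x (i + 1))) then
    ∏ i ∈ Finset.range n, ((G.outDeg (G.src (x i)) : ℝ≥0∞))⁻¹
  else 0

/-- `P` is the joint law of a sequence of independent random walks on `G`, the `j`-th walk
started at `v j`. -/
def IsIndepWalksLaw {V E : Type} [MeasurableSpace E] (G : DigraphStruct V E) (v : ℕ → V)
    (P : Measure (ℕ → ℕ → E)) : Prop :=
  P Set.univ = 1 ∧
    ∀ (m n : ℕ) (x : ℕ → ℕ → E),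
      P {ω | ∀ j < m, ∀ t < n, ω j t = x j t} =
        ∏ j ∈ Finset.range m, edgeWalkCyl G (v j) (x j) n

/-- `μ` is the law of the random walk on `G` started at `o`, recorded as its sequence of crossed
edges. -/
def IsEdgeWalkLaw {V E : Type} [MeasurableSpace E] (G : DigraphStruct V E) (o : V)
    (μ : Measure (ℕ → E)) : Prop :=
  μ Set.univ = 1 ∧ ∀ (n : ℕ) (x : ℕ → E), μ {ω | ∀ i < n, ω i = x i} = edgeWalkCyl G o x n

/-! ### Finite approximations and Gibbs measures on arboreta -/

/-- A finite digraph with vertices and edges labelled by natural numbers. -/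
structure FinDigraph where
  VS : Finset ℕ
  ES : Finset ℕ
  fsrc : ℕ → ℕ
  fdst : ℕ → ℕ

/-- `B` is a spanning in-arborescence of the finite digraph `H` rooted at `z`. -/
def FinDigraph.IsArb (H : FinDigraph) (z : ℕ) (B : Finset ℕ) : Prop :=
  B ⊆ H.ES ∧ (∀ e ∈ B, H.fsrc e ≠ z) ∧
  (∀ v ∈ H.VS, v ≠ z → ∃! e : ℕ, e ∈ B ∧ H.fsrc e = v) ∧
  (∀ v ∈ H.VS, Relation.ReflTransGen
      (fun a b => ∃ e ∈ B, H.fsrc e = a ∧ H.fdst e = b) v z)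

/-- A finite digraph `H` with a distinguished vertex `z`, together with a partial isomorphism
to a digraph on `(V, E)`: vertex and edge domains `A`, `F` in `H` and maps `φV`, `φE` to `V`, `E`. -/
structure PIso (V E : Type) where
  H : FinDigraph
  z : ℕ
  A : Finset ℕ
  F : Finset ℕ
  φV : ℕ → V
  φE : ℕ → E

/-- The data of `p` really is a partial isomorphism to `G`. -/
def PIso.Valid {V E : Type} (p : PIso V E) (G : DigraphStruct V E) : Prop :=
  ↑p.A ⊆ ↑p.H.VS ∧ ↑p.F ⊆ ↑p.H.ES ∧ p.z ∈ p.H.VS ∧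
  Set.InjOn p.φV ↑p.A ∧ Set.InjOn p.φE ↑p.F ∧
  ∀ e ∈ p.F, p.H.fsrc e ∈ p.A ∧ p.H.fdst e ∈ p.A ∧
    G.src (p.φE e) = p.φV (p.H.fsrc e) ∧ G.dst (p.φE e) = p.φV (p.H.fdst e)

/-- The partial isomorphism `p` identifies a neighbourhood of (a preimage of) `w`:
`w` is in the range of `φV` and `φE` maps the edges incident to its preimage bijectively onto
the edges incident to `w`. -/
def PIso.GoodAt {V E : Type} (p : PIso V E) (G : DigraphStruct V E) (w : V) : Prop :=
  ∃ w' ∈ p.A, p.φV w' = w ∧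
    (∀ e' ∈ p.H.ES, (p.H.fsrc e' = w' ∨ p.H.fdst e' = w') → e' ∈ p.F) ∧
    ∀ e : E, (G.src e = w ∨ G.dst e = w) →
      ∃! e' : ℕ, e' ∈ p.F ∧ (p.H.fsrc e' = w' ∨ p.H.fdst e' = w') ∧ p.φE e' = e

/-- `a` is a finite approximation to `G`: a sequence of finite digraphs with distinguished
vertices `zₙ` and partial isomorphisms to `G`, identifying larger and larger neighbourhoods of
every finite vertex set, with the distinguished vertices escaping to infinity. -/
def IsFinApproxSeq {V E : Type} (G : DigraphStruct V E) (a : ℕ → PIso V E) : Prop :=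
  (∀ n, (a n).Valid G) ∧
  (∀ W : Finset V, ∃ N, ∀ n ≥ N, ∀ w ∈ W, (a n).GoodAt G w) ∧
  (∀ W : Finset V, ∃ N, ∀ n ≥ N, ¬((a n).z ∈ (a n).A ∧ (a n).φV (a n).z ∈ (W : Set V)))

/-- The probability, under the uniform spanning in-arborescence of `p.H` rooted at `p.z`, that
every edge of `F` is in the image of the arborescence under the partial isomorphism. -/
noncomputable def pisoUACyl {V E : Type} (p : PIso V E) (F : Finset E) :
    ℝ≥0∞ :=
  (Nat.card {B : Finset ℕ // p.H.IsArb p.z B ∧ ∀ e ∈ F, ∃ e' ∈ B, e' ∈ p.F ∧ p.φE e' = e} :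
      ℝ≥0∞) /
    (Nat.card {B : Finset ℕ // p.H.IsArb p.z B} : ℝ≥0∞)

/-- `μ` (a measure on edge sets, encoded as elements of `E → Bool`) is a Gibbs measure on
spanning in-arboreta of `G` rooted at infinity: it is a weak limit of mixtures (over a random
finite approximation to `G`) of uniform spanning in-arborescence measures on finite
approximations to `G`. -/
def IsArbGibbs {V E : Type} (G : DigraphStruct V E) (μ : Measure (E → Bool)) : Prop :=
  μ Set.univ = 1 ∧
  ∃ (Ω : Type) (mΩ : MeasurableSpace Ω) (ν : @Measure Ω mΩ) (a : Ω → ℕ → PIso V E),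
    ν Set.univ = 1 ∧ (∀ ω : Ω, IsFinApproxSeq G (a ω)) ∧
    ∀ F : Finset E,
      Filter.Tendsto (fun n => ∫⁻ ω, pisoUACyl (a ω n) F ∂ν) Filter.atTop
        (nhds (μ {A : E → Bool | ∀ e ∈ F, A e = true}))

/-! ### Stacks -/

open Classical in
/-- The state (current vertex, remaining stacks) after `n` steps of following the stacks `σ`
starting from `o`: at each step we cross the edge at the front of the list at the current vertex
and delete it from the list (doing nothing if the list is empty). -/
noncomputable def stackState {V E : Type} (G : DigraphStruct V E) (o : V) (σ : V → List E) :
    ℕ → V × (V → List E)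
  | 0 => (o, σ)
  | n + 1 =>
    let p := stackState G o σ n
    match p.2 p.1 with
    | [] => p
    | e :: rest => (G.dst e, Function.update p.2 p.1 rest)

/-- The edge crossed at step `n` when following the stacks `σ` from `o` (`none` if the
current stack is exhausted). -/
noncomputable def stackEdge {V E : Type} (G : DigraphStruct V E) (o : V) (σ : V → List E)
    (n : ℕ) : Option E :=
  ((stackState G o σ n).2 (stackState G o σ n).1).head?

/-- The sigma-algebra on stack configurations. -/
noncomputable def stackMS (V E : Type) : MeasurableSpace (V → List E) :=
  @MeasurableSpace.pi V (fun _ => List E) fun _ => ⊤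

open Classical in
/-- `ρ` is the law of the random stack configuration built from a random arboretum with law `κ`:
place the arboretum edge at the bottom of the stack at each vertex, and an independent,
uniformly random ordering of the remaining outgoing edges on top of it. -/
def IsStackLaw {V E : Type} (G : DigraphStruct V E) (κ : Measure (E → Bool))
    (ρ : @Measure (V → List E) (stackMS V E)) : Prop :=
  ρ Set.univ = 1 ∧
    ∀ (K : Finset V) (s : V → List E),
      ρ {σ | ∀ v ∈ K, σ v = s v} =
        if ∀ v ∈ K, (s v).Nodup ∧ ∀ e : E, e ∈ s v ↔ G.src e = v then
          κ {A | ∀ v ∈ K, ∃ e : E, (s v).getLast? = some e ∧ A e = true} *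
            ∏ v ∈ K, (((G.outDeg v - 1).factorial : ℝ≥0∞))⁻¹
        else 0

/-! ### Markov chains -/

open Classical in
/-- `ν` is the law of the trajectory of a Markov chain with state space `S' ⊆ S`, transition
kernel `p` and deterministic initial state `s0`. -/
def IsMCLaw {S : Type} [MeasurableSpace S] (S' : Set S) (p : S → S → ℝ≥0∞) (s0 : S)
    (ν : Measure (ℕ → S)) : Prop :=
  ν Set.univ = 1 ∧ s0 ∈ S' ∧
  (∀ u ∈ S', (∑' v : S, p u v) = 1 ∧ ∀ v : S, p u v ≠ 0 → v ∈ S') ∧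
  (∀ u : S, u ∉ S' → ∀ v : S, p u v = 0) ∧
  ∀ (n : ℕ) (y : ℕ → S),
    ν {x | ∀ i ≤ n, x i = y i} =
      if y 0 = s0 then ∏ i ∈ Finset.range n, p (y i) (y (i + 1)) else 0

/-- `ν` is the law of the trajectory of a recurrent Markov chain on a subset of `S` with
non-random initial state: the chain returns to its initial state infinitely often a.s. -/
def IsRecMCLaw {S : Type} [MeasurableSpace S] (ν : Measure (ℕ → S)) : Prop :=
  ∃ (S' : Set S) (p : S → S → ℝ≥0∞) (s0 : S),
    IsMCLaw S' p s0 ν ∧ ν {x | {i : ℕ | x i = s0}.Infinite} = 1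

/-- `ν` is the law of the sequence of vertices visited by (the unique) proper Gibbs measure on
Eulerian paths from `o` to `∞` on a sourced Eulerian digraph whose vertex set is a subset
of `S`. -/
def IsGibbsVertexLaw {S : Type} [MeasurableSpace S] (ν : Measure (ℕ → S)) : Prop :=
  ∃ (Vs : Set S) (E : Type) (mE : MeasurableSpace E) (G : DigraphStruct (↥Vs) E) (o : ↥Vs),
    Countable E ∧ G.IsSourcedEulerian o ∧
    ∃ μp : @Measure (ℕ → E) (@MeasurableSpace.pi ℕ (fun _ => E) fun _ => mE),
      @ProperGibbs (↥Vs) E mE G o μp ∧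
      ∀ A : Set (ℕ → S), MeasurableSet A →
        ν A = μp ((fun (γ : ℕ → E) (i : ℕ) => ((G.src (γ i) : S))) ⁻¹' A)

/-- Concatenation of a finite list with an infinite sequence. -/
def concatSeq {S : Type} (l : List S) (y : ℕ → S) : ℕ → S :=
  fun i => if h : i < l.length then l.get ⟨i, h⟩ else y (i - l.length)

/-- `ν` is the law of a process following a uniform random Eulerian path on a finite Eulerian
digraph with source and sink whose vertex set is a subset of `S`, followed by the trajectory of
an (independent) recurrent Markov chain on a disjoint subset of `S` with non-random initial
state. -/
def IsMixedLaw {S : Type} [MeasurableSpace S] (ν : Measure (ℕ → S)) : Prop :=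
  ∃ (Vf : Finset S) (Ef : Type) (_ : Finite Ef)
    (Gf : DigraphStruct {s : S // s ∈ Vf} Ef) (of zf : {s : S // s ∈ Vf})
    (Vr : Set S) (p : S → S → ℝ≥0∞) (s1 : S) (νMC : Measure (ℕ → S)),
    IsFinEulerian Gf of zf ∧ Disjoint (↑Vf : Set S) Vr ∧
    IsMCLaw Vr p s1 νMC ∧ νMC {x | {i : ℕ | x i = s1}.Infinite} = 1 ∧
    ∀ A : Set (ℕ → S), MeasurableSet A →
      ν A =
        (∑' L : {L : List Ef // IsEulerList Gf of zf L},
            νMC ((fun y => concatSeq (((of : S)) ::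
              (L : List Ef).map fun e => ((Gf.dst e : S))) y) ⁻¹' A)) /
          (Nat.card {L : List Ef // IsEulerList Gf of zf L} : ℝ≥0∞)

section Aux
open scoped Classical

/-- successors of `v` along the first `n` steps of `x`, in order -/
noncomputable def stk (x : ℕ → S) : ℕ → S → List S
  | 0, _ => []
  | n + 1, v => if x n = v then stk x n v ++ [x (n + 1)] else stk x n v

lemma stk_succ (x : ℕ → S) (n : ℕ) (v : S) :
    stk x (n + 1) v = if x n = v then stk x n v ++ [x (n + 1)] else stk x n v := rfl

lemma stk_congr {x y : ℕ → S} {n : ℕ} (h : ∀ i ≤ n, x i = y i) (v : S) :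
    stk x n v = stk y n v := by
  induction n with
  | zero => rfl
  | succ n ih =>
    rw [stk_succ, stk_succ, ih (fun i hi => h i (by omega)), h n (by omega), h (n+1) le_rfl]

lemma transCount_eq (x : ℕ → S) (n : ℕ) (u v : S) :
    transCount x n u v = (stk x n u).count v := by
  induction n with
  | zero => simp [transCount, stk]
  | succ n ih =>
    have hfin : ({i : ℕ | i < n ∧ x i = u ∧ x (i + 1) = v}).Finite :=
      (Set.finite_lt_nat n).subset (fun i hi => hi.1)
    rw [stk_succ]
    by_cases h : x n = u ∧ x (n + 1) = v
    · have : {i : ℕ | i < n + 1 ∧ x i = u ∧ x (i + 1) = v}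
          = insert n {i : ℕ | i < n ∧ x i = u ∧ x (i + 1) = v} := by
        ext i
        simp only [Set.mem_setOf_eq, Set.mem_insert_iff]
        constructor
        · rintro ⟨a, b⟩
          rcases Nat.lt_succ_iff_lt_or_eq.1 a with h1 | h1
          · exact Or.inr ⟨h1, b⟩
          · exact Or.inl h1
        · rintro (rfl | ⟨a, b⟩)
          · exact ⟨by omega, h⟩
          · exact ⟨by omega, b⟩
      unfold transCount at ih ⊢
      rw [this, Set.ncard_insert_of_notMem (by simp) hfin, ih, if_pos h.1, List.count_append, h.2]
      simp
    · have : {i : ℕ | i < n + 1 ∧ x i = u ∧ x (i + 1) = v}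
          = {i : ℕ | i < n ∧ x i = u ∧ x (i + 1) = v} := by
        ext i
        simp only [Set.mem_setOf_eq]
        constructor
        · rintro ⟨a, b⟩
          rcases Nat.lt_succ_iff_lt_or_eq.1 a with h1 | h1
          · exact ⟨h1, b⟩
          · subst h1; exact absurd b h
        · rintro ⟨a, b⟩
          exact ⟨by omega, b⟩
      unfold transCount at ih ⊢
      rw [this, ih]
      split_ifs with h1
      · rw [List.count_append]
        have : x (n+1) ≠ v := fun h2 => h ⟨h1, h2⟩
        simp [List.count_singleton, this]
      · rfl

lemma stk_prefix_mono (x : ℕ → S) (v : S) {m n : ℕ} (h : m ≤ n) : stk x m v <+: stk x n v := by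
  induction n, h using Nat.le_induction with
  | base => exact List.prefix_rfl
  | succ n _ ih =>
    rw [stk_succ]
    split_ifs
    · exact ih.trans (List.prefix_append _ _)
    · exact ih

lemma stk_unique {x y : ℕ → S} {n : ℕ} (h0 : x 0 = y 0) (h : ∀ v, stk x n v = stk y n v) :
    ∀ i ≤ n, x i = y i := by
  intro i
  induction i using Nat.strong_induction_on with
  | _ i ih =>
    intro hi
    rcases i with _ | i
    · exact h0
    · have e1 := stk_prefix_mono x (x i) hi
      have e2 := stk_prefix_mono y (x i) hi
      have hxi : x i = y i := ih i (by omega) (by omega)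
      have e3 : stk x i (x i) = stk y i (x i) :=
        stk_congr (fun j hj => ih j (by omega) (by omega)) _
      rw [stk_succ, if_pos rfl] at e1
      rw [stk_succ, if_pos hxi.symm, ← e3, ← h] at e2
      have := List.prefix_of_prefix_length_le e1 e2 (by simp)
      have := this.eq_of_length (by simp)
      simpa using this

lemma stk_cons (o : S) (p : ℕ → S) (n : ℕ) (v : S) :
    stk (fun i => Nat.casesOn i o p) (n + 1) v = (if o = v then [p 0] else []) ++ stk p n v := by
  induction n with
  | zero => simp [stk]
  | succ n ih =>
    rw [stk_succ, ih, stk_succ]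
    simp only
    split_ifs <;> simp

lemma best (n : ℕ) : ∀ (s : S → List S) (K : Finset S) (o z : S) (r : S → ℕ),
    (∀ v ∉ K, s v = []) → (∑ v ∈ K, (s v).length = n) →
    (∀ w, (∑ v ∈ K, (s v).count w) + (if w = o then 1 else 0)
      = (s w).length + if w = z then 1 else 0) →
    (∀ v, v ≠ z → ∀ w, (s v).getLast? = some w → w = z ∨ r w < r v) →
    ∃ p : ℕ → S, p 0 = o ∧ p n = z ∧ ∀ v, stk p n v = s v := by
  induction n with
  | zero =>
    intro s K o z r hK hn hb _
    have hs : ∀ v, s v = [] := by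
      intro v
      by_cases hv : v ∈ K
      · have := (Finset.sum_eq_zero_iff.1 hn) v hv
        exact List.length_eq_zero_iff.1 this
      · exact hK v hv
    have := hb o
    simp [hs] at this
    have hoz : o = z := by
      by_contra hc
      simp [hc] at this
    exact ⟨fun _ => o, rfl, hoz, fun v => by simp [stk, hs]⟩
  | succ n ih =>
    intro s K o z r hK hn hb ht
    have hne : s o ≠ [] := by
      intro ho
      have h1 := hb o
      simp only [ho, List.length_nil, if_true] at h1
      have hoz : o = z := by
        by_contra hc
        simp [hc] at h1
      subst hoz
      have h2 : ∑ v ∈ K, (s v).count o = 0 := by simpa using h1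
      have key : ∀ k, ∀ v, r v ≤ k → s v = [] := by
        intro k
        induction k with
        | zero =>
          intro v hv
          by_contra hc
          have hvo : v ≠ o := fun e => hc (e ▸ ho)
          have hl := List.getLast?_eq_some_getLast hc
          rcases ht v hvo _ hl with h | h
          · have hvK : v ∈ K := by
              by_contra hh; exact hc (hK v hh)
            have := (Finset.sum_eq_zero_iff.1 h2) v hvK
            rw [List.count_eq_zero] at this
            exact this (h ▸ List.getLast_mem hc)
          · omega
        | succ k ihk =>
          intro v hv
          by_contra hc
          have hvo : v ≠ o := fun e => hc (e ▸ ho)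
          have hl := List.getLast?_eq_some_getLast hc
          have hvK : v ∈ K := by
            by_contra hh; exact hc (hK v hh)
          by_cases hlo : (s v).getLast hc = o
          · have := (Finset.sum_eq_zero_iff.1 h2) v hvK
            rw [List.count_eq_zero] at this
            exact this (hlo ▸ List.getLast_mem hc)
          · rcases ht v hvo _ hl with h | h
            · exact hlo h
            · have h3 := ihk ((s v).getLast hc) (by omega)
              have h4 := hb ((s v).getLast hc)
              rw [h3] at h4
              simp only [hlo, if_false, List.length_nil] at h4
              have : ∑ v' ∈ K, (s v').count ((s v).getLast hc) = 0 := by simpa using h4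
              have := (Finset.sum_eq_zero_iff.1 this) v hvK
              rw [List.count_eq_zero] at this
              exact this (List.getLast_mem hc)
      have : ∑ v ∈ K, (s v).length = 0 :=
        Finset.sum_eq_zero (fun v _ => by rw [key (r v) v le_rfl]; rfl)
      omega
    obtain ⟨w, l, hl⟩ := List.exists_cons_of_ne_nil hne
    have hoK : o ∈ K := by
      by_contra hh; exact hne (hK o hh)
    have hupd : ∀ v, v ≠ o → Function.update s o l v = s v := fun v hv => by simp [hv]
    obtain ⟨p, p0, pn, ps⟩ := ih (Function.update s o l) K w z r
      (by
        intro v hv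
        rw [hupd v (fun e => hv (e ▸ hoK))]; exact hK v hv)
      (by
        rw [← Finset.add_sum_erase _ _ hoK] at hn ⊢
        rw [Finset.sum_congr rfl (fun v hv => by rw [hupd v (Finset.ne_of_mem_erase hv)])]
        simp [hl] at hn ⊢
        omega)
      (by
        intro u
        have := hb u
        rw [← Finset.add_sum_erase _ _ hoK] at this ⊢
        rw [Finset.sum_congr rfl (fun v hv => by rw [hupd v (Finset.ne_of_mem_erase hv)])]
        rw [hl, List.count_cons] at this
        simp only [Function.update_self]
        by_cases huo : u = o
        · subst huo
          simp only [hl, List.length_cons, Function.update_self, if_true, beq_iff_eq] at this ⊢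
          by_cases hwu : w = u
          · simp [hwu] at this ⊢; omega
          · simp [hwu, Ne.symm hwu] at this ⊢; omega
        · rw [hupd u huo]
          by_cases hwu : w = u
          · simp [hwu, huo] at this ⊢; omega
          · simp [hwu, Ne.symm hwu, huo] at this ⊢; omega)
      (by
        intro v hv u hu
        by_cases hvo : v = o
        · subst hvo
          simp only [Function.update_self] at hu
          refine ht v hv u ?_
          rw [hl, List.getLast?_cons, hu]; rfl
        · rw [hupd v hvo] at hu
          exact ht v hv u hu)
    refine ⟨fun i => Nat.casesOn i o p, rfl, pn, fun v => ?_⟩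
    rw [stk_cons, ps, p0]
    by_cases hvo : o = v
    · subst hvo; simp [hl]
    · rw [hupd v (Ne.symm hvo)]; simp [hvo]

lemma stk_balance (x : ℕ → S) (K : Finset S) (n : ℕ) (hK : ∀ i < n, x i ∈ K) (w : S) :
    (∑ v ∈ K, (stk x n v).count w) + (if w = x 0 then 1 else 0)
      = (stk x n w).length + if w = x n then 1 else 0 := by
  induction n with
  | zero => simp [stk]
  | succ n ih =>
    have ih := ih (fun i hi => hK i (by omega))
    have hx := hK n (by omega)
    rw [← Finset.add_sum_erase _ _ hx] at ih ⊢
    rw [Finset.sum_congr rfl (g := fun v => (stk x n v).count w)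
      (fun v hv => by rw [stk_succ, if_neg (Finset.ne_of_mem_erase hv).symm])]
    rw [stk_succ, stk_succ, if_pos rfl, List.count_append, List.count_singleton]
    by_cases h1 : x n = w
    · subst h1
      by_cases h2 : x (n+1) = x n
      · simp [h2] at ih ⊢; omega
      · simp [h2, Ne.symm h2] at ih ⊢; omega
    · by_cases h2 : x (n+1) = w
      · simp [h1, h2, Ne.symm h1] at ih ⊢; omega
      · simp [h1, h2, Ne.symm h1, Ne.symm h2] at ih ⊢; omega

lemma stk_rank (x : ℕ → S) (n : ℕ) : ∃ r : S → ℕ, (∀ v, r v ≤ n) ∧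
    ∀ v, v ≠ x n → ∀ w, (stk x n v).getLast? = some w → w = x n ∨ r w < r v := by
  induction n with
  | zero => exact ⟨fun _ => 0, by simp, by simp [stk]⟩
  | succ n ih =>
    obtain ⟨r, hr, h⟩ := ih
    refine ⟨fun v => if v = x n then 0 else r v + 1, ?_, ?_⟩
    · intro v; have := hr v; dsimp only; split_ifs <;> omega
    · intro v hv w hw
      rw [stk_succ] at hw
      by_cases h1 : x n = v
      · simp [h1] at hw; left; exact hw.symm
      · rw [if_neg h1] at hw
        right
        have h2 := h v (Ne.symm h1) w hw
        simp only [Ne.symm h1, if_false]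
        split_ifs with h3
        · omega
        · rcases h2 with h2 | h2
          · exact absurd h2 h3
          · omega

lemma stk_nil_of (x : ℕ → S) (n : ℕ) (v : S) (h : ∀ i < n, x i ≠ v) : stk x n v = [] := by
  induction n with
  | zero => rfl
  | succ n ih =>
    rw [stk_succ, if_neg (h n (by omega)), ih (fun i hi => h i (by omega))]

lemma stk_length_sum (x : ℕ → S) (K : Finset S) (n : ℕ) (hK : ∀ i < n, x i ∈ K) :
    ∑ v ∈ K, (stk x n v).length = n := by
  induction n with
  | zero => simp [stk]
  | succ n ih =>
    have ih := ih (fun i hi => hK i (by omega))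
    have hx := hK n (by omega)
    rw [← Finset.add_sum_erase _ _ hx] at ih ⊢
    rw [Finset.sum_congr rfl (g := fun v => (stk x n v).length)
      (fun v hv => by rw [stk_succ, if_neg (Finset.ne_of_mem_erase hv).symm])]
    rw [stk_succ, if_pos rfl]
    simp; omega

lemma stk_const (x : ℕ → S) (v : S) {m n : ℕ} (h : m ≤ n) (hx : ∀ i ≥ m, x i ≠ v) :
    stk x n v = stk x m v := by
  induction n, h using Nat.le_induction with
  | base => rfl
  | succ n hn ih => rw [stk_succ, if_neg (hx n hn), ih]

/-- the full list of successors of `v` (if `v` is visited finitely often) -/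
noncomputable def stack (x : ℕ → S) (v : S) : List S :=
  if h : ∃ N, ∀ i ≥ N, x i ≠ v then stk x (Nat.find h) v else []

lemma stack_eq {x : ℕ → S} {v : S} {N : ℕ} (h : ∀ i ≥ N, x i ≠ v) :
    stack x v = stk x N v := by
  have h' : ∃ N, ∀ i ≥ N, x i ≠ v := ⟨N, h⟩
  rw [stack, dif_pos h']
  exact (stk_const x v (Nat.find_min' h' h) (Nat.find_spec h')).symm

/-- transient sequences -/
def Tr (x : ℕ → S) : Prop := ∀ v, ∃ N, ∀ i ≥ N, x i ≠ v

lemma Tr_iff (x : ℕ → S) : Tr x ↔ ∀ s : S, {i : ℕ | x i = s}.Finite := by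
  unfold Tr
  refine forall_congr' fun v => ?_
  constructor
  · rintro ⟨N, h⟩
    refine (Set.finite_lt_nat N).subset (fun i hi => ?_)
    by_contra hc
    exact h i (by simpa using hc) hi
  · intro h
    obtain ⟨N, hN⟩ := h.bddAbove
    exact ⟨N + 1, fun i hi hx => by have := hN hx; omega⟩

lemma Tr.finset {x : ℕ → S} (h : Tr x) (W : Finset S) : ∃ N, ∀ i ≥ N, x i ∉ W := by
  choose N hN using h
  refine ⟨W.sup N, fun i hi hx => hN (x i) i ?_ rfl⟩
  exact (Finset.le_sup (f := N) hx).trans hi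

/-- replace the first part of `x` by `p` -/
def splice (N : ℕ) (p x : ℕ → S) : ℕ → S := fun i => if i ≤ N then p i else x i

lemma stk_splice {N : ℕ} {p x : ℕ → S} (hN : p N = x N) (v : S) (n : ℕ) (hn : N ≤ n) :
    ∃ d, stk (splice N p x) n v = stk p N v ++ d ∧ stk x n v = stk x N v ++ d := by
  induction n, hn using Nat.le_induction with
  | base =>
    refine ⟨[], ?_, by simp⟩
    rw [List.append_nil]
    exact stk_congr (fun i hi => by simp [splice, hi]) v
  | succ n hn ih =>
    obtain ⟨d, h1, h2⟩ := ih
    have e1 : splice N p x n = x n := by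
      unfold splice
      split_ifs with h
      · rw [le_antisymm h hn, hN]
      · rfl
    have e2 : splice N p x (n+1) = x (n+1) := by
      unfold splice
      rw [if_neg (by omega)]
    rw [stk_succ, stk_succ, h1, h2, e1, e2]
    by_cases h : x n = v
    · exact ⟨d ++ [x (n+1)], by simp [h], by simp [h]⟩
    · exact ⟨d, by simp [h], by simp [h]⟩

lemma splice_ge {N : ℕ} {p x : ℕ → S} (hN : p N = x N) (i : ℕ) (hi : N ≤ i) :
    splice N p x i = x i := by
  unfold splice
  split_ifs with h
  · rw [le_antisymm h hi, hN]
  · rfl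

lemma Tr_splice {N : ℕ} {p x : ℕ → S} (hN : p N = x N) (h : Tr x) : Tr (splice N p x) := by
  intro v
  obtain ⟨n, hn⟩ := h v
  exact ⟨max n N, fun i hi => by
    rw [splice_ge hN i (by omega)]; exact hn i (by omega)⟩

lemma stack_splice_eq {N : ℕ} {p x : ℕ → S} (hN : p N = x N) (h : Tr x) (v : S)
    (hv : stk p N v = stk x N v) : stack (splice N p x) v = stack x v := by
  obtain ⟨n, hn⟩ := h v
  have h1 : ∀ i ≥ max n N, x i ≠ v := fun i hi => hn i (by omega)
  have h2 : ∀ i ≥ max n N, splice N p x i ≠ v := fun i hi => by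
    rw [splice_ge hN i (by omega)]; exact h1 i hi
  rw [stack_eq h1, stack_eq h2]
  obtain ⟨d, a, b⟩ := stk_splice hN v (max n N) (le_max_right _ _)
  rw [a, b, hv]

lemma finEquiv_of_stk {x y : ℕ → S} {n : ℕ} (h0 : x 0 = y 0)
    (h : ∀ v, (stk x n v).Perm (stk y n v)) : FinEquiv x y n := by
  refine ⟨h0, fun u v => ?_⟩
  rw [transCount_eq, transCount_eq]
  exact (h u).count_eq v

end Aux

section Aux2
open scoped Classical

/-- the last-exit edges restricted to `W` have no directed cycle -/
def Acyc {W : Finset S} (t : W → List S) : Prop :=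
  ∃ r : W → ℕ, ∀ v w : W, (t v).getLast? = some (w : S) → r w < r v

/-- `W` is closed under taking the past in the last-exit forest -/
def PC (W : Finset S) (x : ℕ → S) : Prop :=
  ∀ v ∉ W, ∀ w ∈ W, (stack x v).getLast? ≠ some w

/-- `W` is the largest past-closed subset of `B` -/
def HB (B W : Finset S) (x : ℕ → S) : Prop :=
  W ⊆ B ∧ PC W x ∧ ∀ W', W' ⊆ B → PC W' x → W' ⊆ W

/-- after time `N`, no visit to `W` or to a vertex with an edge to `W` -/
def RN (W : Finset S) (N : ℕ) (x : ℕ → S) : Prop :=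
  ∀ i ≥ N, x i ∉ W ∧ ∀ w ∈ W, w ∉ stack x (x i)

lemma acyc_stack {x : ℕ → S} (hx : Tr x) (W : Finset S) : Acyc (fun v : W => stack x v) := by
  obtain ⟨N, hN⟩ := hx.finset W
  obtain ⟨r, -, hr⟩ := stk_rank x N
  refine ⟨fun v => r v, fun v w h => ?_⟩
  have hv : (v : S) ≠ x N := fun e => hN N le_rfl (e ▸ v.2)
  have hst : stack x v = stk x N v := stack_eq (fun i hi e => hN i hi (e ▸ v.2))
  simp only [hst] at h
  rcases hr v hv w h with h | h
  · exact absurd w.2 (h ▸ hN N le_rfl)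
  · exact h

lemma PC_union {W W' : Finset S} {x : ℕ → S} (h : PC W x) (h' : PC W' x) : PC (W ∪ W') x := by
  intro v hv w hw
  simp only [Finset.mem_union, not_or] at hv hw
  rcases hw with hw | hw
  · exact h v hv.1 w hw
  · exact h' v hv.2 w hw

lemma HB_congr {B W : Finset S} {x y : ℕ → S} (h : HB B W x)
    (hxy : ∀ v ∉ W, stack y v = stack x v) : HB B W y := by
  obtain ⟨h1, h2, h3⟩ := h
  refine ⟨h1, fun v hv w hw => by rw [hxy v hv]; exact h2 v hv w hw, fun W' hW' hP => ?_⟩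
  have : PC (W ∪ W') x := by
    intro v hv w hw
    simp only [Finset.mem_union, not_or] at hv hw
    rcases hw with hw | hw
    · exact h2 v hv.1 w hw
    · rw [← hxy v hv.1]; exact hP v hv.2 w hw
  exact (Finset.union_subset_iff.1 (h3 _ (Finset.union_subset h1 hW') this)).2

lemma HB_unique {B W W' : Finset S} {x : ℕ → S} (h : HB B W x) (h' : HB B W' x) : W = W' :=
  Finset.Subset.antisymm (h'.2.2 _ h.1 h.2.1) (h.2.2 _ h'.1 h'.2.1)

lemma HB_exists (B : Finset S) (x : ℕ → S) : ∃ W, HB B W x := by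
  refine ⟨(B.powerset.filter (fun W => PC W x)).sup id, ?_, ?_, ?_⟩
  · refine Finset.sup_le fun W hW => ?_
    exact Finset.mem_powerset.1 (Finset.mem_filter.1 hW).1
  · refine Finset.sup_induction (p := fun W => PC W x) ?_ (fun a ha b hb => PC_union ha hb)
      (fun W hW => ?_)
    · intro v _ w hw; simp at hw
    · exact (Finset.mem_filter.1 hW).2
  · intro W' h1 h2
    exact Finset.le_sup (f := id) (Finset.mem_filter.2 ⟨Finset.mem_powerset.2 h1, h2⟩)

lemma mem_stk {x : ℕ → S} {n : ℕ} {v w : S} (h : w ∈ stk x n v) :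
    ∃ i < n, x i = v ∧ x (i + 1) = w := by
  induction n with
  | zero => simp [stk] at h
  | succ n ih =>
    rw [stk_succ] at h
    split_ifs at h with h1
    · rw [List.mem_append, List.mem_singleton] at h
      rcases h with h | h
      · obtain ⟨i, a, b⟩ := ih h
        exact ⟨i, by omega, b⟩
      · exact ⟨n, by omega, h1, h.symm⟩
    · obtain ⟨i, a, b⟩ := ih h
      exact ⟨i, by omega, b⟩

lemma mem_stk_of {x : ℕ → S} {n i : ℕ} (h : i < n) : x (i + 1) ∈ stk x n (x i) := by
  have := stk_prefix_mono x (x i) (show i + 1 ≤ n by omega)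
  refine this.subset ?_
  rw [stk_succ]; simp

lemma mem_stack_of {x : ℕ → S} (hx : Tr x) (i : ℕ) : x (i + 1) ∈ stack x (x i) := by
  obtain ⟨N, hN⟩ := hx (x i)
  rw [stack_eq (N := max N (i+1)) (fun j hj => hN j (by omega))]
  exact mem_stk_of (by omega)

lemma mem_stack {x : ℕ → S} {v w : S} (h : w ∈ stack x v) :
    ∃ i, x i = v ∧ x (i + 1) = w := by
  unfold stack at h
  split_ifs at h with h1
  · obtain ⟨i, _, b⟩ := mem_stk h
    exact ⟨i, b⟩
  · simp at h

lemma stk_prefix_stack {x : ℕ → S} (hx : Tr x) (n : ℕ) (v : S) : stk x n v <+: stack x v := by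
  obtain ⟨N, hN⟩ := hx v
  rw [stack_eq (N := max N n) (fun j hj => hN j (by omega))]
  exact stk_prefix_mono _ _ (by omega)

lemma RN_mono {W : Finset S} {x : ℕ → S} {N N' : ℕ} (h : RN W N x) (hN : N ≤ N') : RN W N' x :=
  fun i hi => h i (by omega)

lemma RN_exists {x : ℕ → S} (hx : Tr x) (W : Finset S) : ∃ N, RN W N x := by
  obtain ⟨N, hN⟩ := hx.finset W
  -- the predecessors of W form a finite set
  obtain ⟨N', hN'⟩ := hx.finset ((Finset.range N).image x)
  refine ⟨max N N', fun i hi => ⟨hN i (by omega), fun w hw hmem => ?_⟩⟩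
  obtain ⟨j, hj1, hj2⟩ := mem_stack hmem
  have : j + 1 < N := by
    by_contra hc
    exact hN (j+1) (by omega) (hj2 ▸ hw)
  exact hN' i (by omega) (Finset.mem_image.2 ⟨j, Finset.mem_range.2 (by omega), hj1⟩)

lemma swap_exists {x : ℕ → S} (hx : Tr x) {W : Finset S} {N : ℕ} (hP : PC W x) (hR : RN W N x)
    (t' : W → List S) (ht : ∀ v, (t' v).Perm (stack x v)) (hA : Acyc t') :
    ∃ p' : ℕ → S, p' 0 = x 0 ∧ p' N = x N ∧ (∀ v : W, stk p' N v = t' v) ∧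
      ∀ v ∉ W, stk p' N v = stk x N v := by
  have hW : ∀ v : W, stack x v = stk x N v := fun v =>
    stack_eq (fun i hi e => (hR i hi).1 (e ▸ v.2))
  set K : Finset S := (Finset.range N).image x with hK
  have hKm : ∀ i < N, x i ∈ K := fun i hi =>
    Finset.mem_image.2 ⟨i, Finset.mem_range.2 hi, rfl⟩
  set s : S → List S := fun v => if h : v ∈ W then t' ⟨v, h⟩ else stk x N v with hs
  have hsp : ∀ v, (s v).Perm (stk x N v) := by
    intro v
    simp only [hs]
    split_ifs with h
    · rw [← hW ⟨v, h⟩]; exact ht _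
    · exact List.Perm.refl _
  obtain ⟨r, hr, hr'⟩ := stk_rank x N
  obtain ⟨rW, hrW⟩ := hA
  obtain ⟨p, p0, pN, ps⟩ := best N s K (x 0) (x N)
    (fun v => if h : v ∈ W then N + 1 + rW ⟨v, h⟩ else r v)
    (by
      intro v hv
      have : stk x N v = [] := stk_nil_of x N v (fun i hi e => hv (e ▸ hKm i hi))
      have h2 := hsp v
      rw [this] at h2
      exact h2.eq_nil)
    (by
      rw [← stk_length_sum x K N hKm]
      exact Finset.sum_congr rfl (fun v _ => (hsp v).length_eq))
    (by
      intro w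
      rw [(hsp w).length_eq, ← stk_balance x K N hKm w]
      congr 1
      exact Finset.sum_congr rfl (fun v _ => (hsp v).count_eq w))
    (by
      intro v hv w hw
      by_cases hvW : v ∈ W
      · simp only [hs, dif_pos hvW] at hw ⊢
        by_cases hwW : w ∈ W
        · right
          have := hrW ⟨v, hvW⟩ ⟨w, hwW⟩ hw
          simp only [dif_pos hwW]; omega
        · right
          simp only [dif_neg hwW]
          have := hr w
          omega
      · simp only [hs, dif_neg hvW] at hw ⊢
        have hwW : w ∉ W := by
          intro hwW
          by_cases hvis : ∃ i ≥ N, x i = v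
          · obtain ⟨i, hi, hiv⟩ := hvis
            refine (hR i hi).2 w hwW ?_
            rw [hiv]
            exact (stk_prefix_stack hx N v).subset (List.mem_of_getLast? hw)
          · push Not at hvis
            rw [← stack_eq hvis] at hw
            exact hP v hvW w hwW hw
        rw [dif_neg hwW]
        exact hr' v hv w hw)
  refine ⟨p, p0, pN, fun v => ?_, fun v hv => ?_⟩
  · rw [ps]; simp [hs]
  · rw [ps]; simp [hs, hv]

lemma swap_props {x : ℕ → S} (hx : Tr x) {B W : Finset S} {N : ℕ} (hH : HB B W x)
    (hR : RN W N x) (t' : W → List S) (ht : ∀ v, (t' v).Perm (stack x v))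
    {p' : ℕ → S} (h0 : p' 0 = x 0) (hN : p' N = x N) (hpt : ∀ v : W, stk p' N v = t' v)
    (hpn : ∀ v ∉ W, stk p' N v = stk x N v) :
    Tr (splice N p' x) ∧ splice N p' x 0 = x 0 ∧ InfEquiv x (splice N p' x) ∧
      HB B W (splice N p' x) ∧ RN W N (splice N p' x) ∧
      ∀ v : W, stack (splice N p' x) v = t' v := by
  have hW : ∀ v : W, stack x v = stk x N v := fun v =>
    stack_eq (fun i hi e => (hR i hi).1 (e ▸ v.2))
  have hoff : ∀ v ∉ W, stack (splice N p' x) v = stack x v := fun v hv =>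
    stack_splice_eq hN hx v (hpn v hv)
  have e0 : splice N p' x 0 = x 0 := by simp [splice, h0]
  have estk : ∀ v, stk (splice N p' x) N v = stk p' N v := fun v =>
    stk_congr (fun i hi => by simp [splice, hi]) v
  refine ⟨Tr_splice hN hx, e0, ⟨N, fun n hn => (splice_ge hN n hn).symm, ?_⟩, HB_congr hH hoff,
    ?_, ?_⟩
  · refine finEquiv_of_stk e0.symm (fun v => ?_)
    rw [estk]
    by_cases hv : v ∈ W
    · have h1 := hpt ⟨v, hv⟩
      have h2 := hW ⟨v, hv⟩
      simp only at h1 h2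
      rw [h1, ← h2]
      exact (ht ⟨v, hv⟩).symm
    · rw [hpn v hv]
  · intro i hi
    rw [splice_ge hN i hi]
    refine ⟨(hR i hi).1, ?_⟩
    rw [hoff _ (hR i hi).1]
    exact (hR i hi).2
  · intro v
    rw [← hpt v, ← estk]
    refine stack_eq (fun i hi e => ?_)
    rw [splice_ge hN i hi] at e
    exact (hR i hi).1 (e ▸ v.2)

/-- every finite set is contained in a finite past-closed set -/
lemma PC_superset {x : ℕ → S} (hx : Tr x) (U : Finset S) : ∃ W, U ⊆ W ∧ PC W x := by
  obtain ⟨N, hN⟩ := hx.finset U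
  refine ⟨U ∪ ((Finset.range N).image x).filter (fun v => ∀ i ≥ N, x i ≠ v),
    Finset.subset_union_left, ?_⟩
  set W := U ∪ ((Finset.range N).image x).filter (fun v => ∀ i ≥ N, x i ≠ v) with hWdef
  have hWN : ∀ w ∈ W, ∀ i ≥ N, x i ≠ w := by
    intro w hw i hi e
    rw [hWdef, Finset.mem_union, Finset.mem_filter] at hw
    rcases hw with hw | hw
    · exact hN i hi (e ▸ hw)
    · exact hw.2 i hi e
  intro v hv w hw hl
  have hmem := List.mem_of_getLast? hl
  by_cases hvis : ∃ i ≥ N, x i = v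
  · -- the last exit of v is after time N
    obtain ⟨i, hi, hiv⟩ := hvis
    obtain ⟨n, hn⟩ := hx v
    have key : ∀ m, i < m → (stk x m v).getLast? = some w → False := by
      intro m hm
      induction m, hm using Nat.le_induction with
      | base =>
        rw [stk_succ, if_pos hiv]
        intro h
        simp at h
        exact hWN w hw (i+1) (by omega) h
      | succ m hm ih =>
        intro h
        rw [stk_succ] at h
        split_ifs at h with h1
        · simp at h
          have : i + 1 ≤ m := hm
          exact hWN w hw (m+1) (by omega) h
        · exact ih h
    rw [stack_eq (N := max n (i+1)) (fun j hj => hn j (by omega))] at hl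
    exact key _ (by omega) hl
  · push Not at hvis
    obtain ⟨j, hj, _⟩ := mem_stack hmem
    refine hv ?_
    rw [hWdef, Finset.mem_union, Finset.mem_filter]
    refine Or.inr ⟨Finset.mem_image.2 ⟨j, Finset.mem_range.2 ?_, hj⟩, hvis⟩
    by_contra hc
    exact hvis j (by omega) hj

end Aux2

section Aux3
open scoped Classical

/-- extension of a finite prefix to a sequence -/
def pext {n : ℕ} (c : Fin (n + 1) → S) : ℕ → S := fun i => c ⟨min i n, by omega⟩

/-- restriction of a sequence to a prefix -/
def pres (n : ℕ) (x : ℕ → S) : Fin (n + 1) → S := fun i => x i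

lemma pext_pres (n : ℕ) (x : ℕ → S) (i : ℕ) (hi : i ≤ n) : pext (pres n x) i = x i := by
  simp [pext, pres, hi]

lemma pres_eq_iff {n : ℕ} {x : ℕ → S} {c : Fin (n + 1) → S} :
    pres n x = c ↔ ∀ i ≤ n, x i = pext c i := by
  constructor
  · rintro rfl i hi
    rw [pext_pres n x i hi]
  · intro h
    funext i
    have := h i (by omega)
    simp only [pext] at this
    simp only [pres, this]
    congr 1
    ext
    simp; omega

/-- the cylinder set of the prefix of length `n` of `c` -/
def cyl (n : ℕ) (c : ℕ → S) : Set (ℕ → S) := {ω | ∀ i ≤ n, ω i = c i}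

lemma cyl_congr {n : ℕ} {c d : ℕ → S} (h : ∀ i ≤ n, c i = d i) : cyl n c = cyl n d := by
  ext ω
  constructor
  · intro hω i hi; rw [← h i hi]; exact hω i hi
  · intro hω i hi; rw [h i hi]; exact hω i hi

section meas
variable {Ω : Type} [MeasurableSpace Ω]
lemma mall {ι : Type} [Countable ι] {P : ι → Ω → Prop} (h : ∀ i, MeasurableSet {x | P i x}) :
    MeasurableSet {x | ∀ i, P i x} := by
  have : {x | ∀ i, P i x} = ⋂ i, {x | P i x} := by ext; simp
  rw [this]; exact MeasurableSet.iInter h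
lemma mex {ι : Type} [Countable ι] {P : ι → Ω → Prop} (h : ∀ i, MeasurableSet {x | P i x}) :
    MeasurableSet {x | ∃ i, P i x} := by
  have : {x | ∃ i, P i x} = ⋃ i, {x | P i x} := by ext; simp
  rw [this]; exact MeasurableSet.iUnion h
lemma mand {P Q : Ω → Prop} (h : MeasurableSet {x | P x}) (h' : MeasurableSet {x | Q x}) :
    MeasurableSet {x | P x ∧ Q x} := h.inter h'
lemma mnot {P : Ω → Prop} (h : MeasurableSet {x | P x}) : MeasurableSet {x | ¬ P x} := h.compl
lemma mimp {P Q : Ω → Prop} (h : MeasurableSet {x | P x}) (h' : MeasurableSet {x | Q x}) :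
    MeasurableSet {x | P x → Q x} := by
  have : {x | P x → Q x} = {x | P x}ᶜ ∪ {x | Q x} := by ext; simp [imp_iff_not_or]
  rw [this]; exact h.compl.union h'
lemma mconst (p : Prop) : MeasurableSet {_x : Ω | p} := MeasurableSet.const p
end meas

variable [Countable S] [MeasurableSpace S] [DiscreteMeasurableSpace S]

lemma meas_of_init (n : ℕ) (Q : Set (ℕ → S))
    (h : ∀ x y : ℕ → S, (∀ i ≤ n, x i = y i) → x ∈ Q → y ∈ Q) : MeasurableSet Q := by
  have hm : Measurable (pres n : (ℕ → S) → Fin (n + 1) → S) := by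
    refine measurable_pi_lambda _ (fun i => measurable_pi_apply _)
  have : Q = pres n ⁻¹' {c | pext c ∈ Q} := by
    ext x
    simp only [mem_preimage, Set.mem_ofPred_eq]
    constructor
    · exact h _ _ (fun i hi => (pext_pres n x i hi).symm)
    · exact h _ _ (fun i hi => (pext_pres n x i hi))
  rw [this]
  exact hm (Set.to_countable _).measurableSet

lemma meas_cyl (n : ℕ) (c : ℕ → S) : MeasurableSet (cyl n c) :=
  meas_of_init n _ (fun x y h hx i hi => by rw [← h i hi]; exact hx i hi)

lemma meas_stack_eq (v : S) (l : List S) : MeasurableSet {x : ℕ → S | stack x v = l} := by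
  have hN : ∀ N : ℕ, MeasurableSet {x : ℕ → S | ∀ i, i ≥ N → x i ≠ v} := fun N =>
    mall fun i => mimp (mconst _) (meas_of_init i _ (fun x y h hx => by
      simp only [Set.mem_ofPred_eq] at hx ⊢
      rw [← h i le_rfl]; exact hx))
  have : {x : ℕ → S | stack x v = l} =
      {x | ∃ N, (∀ i, i ≥ N → x i ≠ v) ∧ stk x N v = l} ∪
        {x | (¬ ∃ N, ∀ i, i ≥ N → x i ≠ v) ∧ [] = l} := by
    ext x
    simp only [Set.mem_union, Set.mem_ofPred_eq]
    by_cases hx : ∃ N, ∀ i, i ≥ N → x i ≠ v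
    · obtain ⟨N, hN⟩ := hx
      constructor
      · intro h
        exact Or.inl ⟨N, hN, by rw [← stack_eq hN]; exact h⟩
      · rintro (⟨N', h1, h2⟩ | h)
        · rw [stack_eq h1]; exact h2
        · exact absurd ⟨N, hN⟩ h.1
    · have : stack x v = [] := by unfold stack; rw [dif_neg hx]
      rw [this]
      constructor
      · intro h; exact Or.inr ⟨hx, h⟩
      · rintro (⟨N', h1, h2⟩ | h)
        · exact absurd ⟨N', h1⟩ hx
        · exact h.2
  rw [this]
  refine MeasurableSet.union (mex fun N => mand (hN N) ?_) (mand (mnot (mex hN)) (mconst _))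
  exact meas_of_init N _ (fun x y h hx => by
    simp only [Set.mem_ofPred_eq] at hx ⊢
    rw [← stk_congr h]; exact hx)

lemma meas_stack (v : S) (P : List S → Prop) : MeasurableSet {x : ℕ → S | P (stack x v)} := by
  have : {x : ℕ → S | P (stack x v)} = {x | ∃ l, stack x v = l ∧ P l} := by
    ext x; simp
  rw [this]
  exact mex fun l => mand (meas_stack_eq v l) (mconst _)

lemma meas_Tr : MeasurableSet {x : ℕ → S | Tr x} := by
  refine mall fun v => mex fun N => mall fun i => mimp (mconst _) ?_
  exact meas_of_init i _ (fun x y h hx => by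
      simp only [Set.mem_ofPred_eq] at hx ⊢
      rw [← h i le_rfl]; exact hx)

lemma meas_PC (W : Finset S) : MeasurableSet {x : ℕ → S | PC W x} := by
  refine mall fun v => mimp (mconst _) (mall fun w => mimp (mconst _) ?_)
  exact meas_stack v (fun l => l.getLast? ≠ some w)

lemma meas_HB (B W : Finset S) : MeasurableSet {x : ℕ → S | HB B W x} := by
  refine mand (mconst _) (mand (meas_PC W) (mall fun W' => ?_))
  exact mimp (mconst _) (mimp (meas_PC W') (mconst _))

lemma meas_RN (W : Finset S) (N : ℕ) : MeasurableSet {x : ℕ → S | RN W N x} := by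
  have hi : ∀ i : ℕ, ∀ P : S → Prop, MeasurableSet {x : ℕ → S | P (x i)} := fun i P =>
    meas_of_init i _ (fun x y h hx => by
      simp only [Set.mem_ofPred_eq] at hx ⊢
      rw [← h i le_rfl]; exact hx)
  refine mall fun i => mimp (mconst _) (mand (hi i (fun s => s ∉ W)) (mall fun w =>
    mimp (mconst _) ?_))
  have : {x : ℕ → S | w ∉ stack x (x i)} = {x | ∀ v, x i = v → w ∉ stack x v} := by
    ext x; simp
  rw [this]
  exact mall fun v => mimp (hi i (fun s => s = v)) (meas_stack v (fun l => w ∉ l))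

lemma meas_splice (N : ℕ) (p : ℕ → S) : Measurable (splice N p) := by
  refine measurable_pi_lambda _ (fun i => ?_)
  unfold splice
  split_ifs
  · exact measurable_const
  · exact measurable_pi_apply _

lemma pi_cyl (N : ℕ) : IsPiSystem {s : Set (ℕ → S) | ∃ n ≥ N, ∃ c, s = cyl n c} := by
  rintro _ ⟨n, hn, c, rfl⟩ _ ⟨m, hm, d, rfl⟩ ⟨ω, h1, h2⟩
  rcases le_total n m with h | h
  · refine ⟨m, hm, d, ?_⟩
    refine Set.inter_eq_right.2 (fun ω' hω' i hi => ?_)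
    rw [hω' i (by omega), ← h2 i (by omega), h1 i hi]
  · refine ⟨n, hn, c, ?_⟩
    refine Set.inter_eq_left.2 (fun ω' hω' i hi => ?_)
    rw [hω' i (by omega), ← h1 i (by omega), h2 i hi]

lemma gen_cyl (N : ℕ) : (inferInstance : MeasurableSpace (ℕ → S)) =
    MeasurableSpace.generateFrom {s : Set (ℕ → S) | ∃ n ≥ N, ∃ c, s = cyl n c} := by
  refine le_antisymm ?_ (MeasurableSpace.generateFrom_le ?_)
  · refine iSup_le fun i => ?_
    rintro _ ⟨s, _, rfl⟩
    have : (fun f : ℕ → S => f i) ⁻¹' s =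
        ⋃ c : {c : Fin (max N i + 1) → S // pext c i ∈ s}, cyl (max N i) (pext c.1) := by
      ext x
      simp only [mem_preimage, mem_iUnion]
      constructor
      · intro h
        refine ⟨⟨pres (max N i) x, ?_⟩, fun j hj => (pext_pres _ x j hj).symm⟩
        rw [pext_pres _ x i (by omega)]; exact h
      · rintro ⟨⟨c, hc⟩, h⟩
        rw [h i (by omega)]; exact hc
    rw [this]
    refine MeasurableSet.iUnion fun c => ?_
    exact MeasurableSpace.measurableSet_generateFrom ⟨_, by omega, _, rfl⟩
  · rintro _ ⟨n, _, c, rfl⟩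
    exact meas_cyl n c

lemma map_splice (μ : Measure (ℕ → S)) [IsFiniteMeasure μ] (hPE : PartiallyExchangeable μ)
    {N : ℕ} {p p' : ℕ → S} (hpp : FinEquiv p p' N) (hN : p N = p' N) :
    (μ.restrict (cyl N p)).map (splice N p') = μ.restrict (cyl N p') := by
  refine ext_of_generate_finite _ (gen_cyl N) (pi_cyl N) ?_ ?_
  · rintro _ ⟨n, hn, c, rfl⟩
    rw [Measure.map_apply (meas_splice N p') (meas_cyl n c),
      Measure.restrict_apply (meas_splice N p' (meas_cyl n c)), Measure.restrict_apply (meas_cyl n c)]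
    by_cases hc : ∀ i ≤ N, c i = p' i
    · have e1 : splice N p' ⁻¹' cyl n c ∩ cyl N p = cyl n (splice N p c) := by
        ext ω
        constructor
        · rintro ⟨h1, h2⟩ i hi
          have := h1 i hi
          unfold splice at this ⊢
          split_ifs with h
          · exact h2 i h
          · simpa [h] using this
        · intro h
          refine ⟨fun i hi => ?_, fun i hi => ?_⟩
          · have := h i hi
            unfold splice at this ⊢
            split_ifs with h'
            · exact (hc i h').symm
            · simpa [h'] using this
          · have := h i (by omega)
            simpa [splice, hi] using this
      have e2 : cyl n c ∩ cyl N p' = cyl n c := by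
        refine Set.inter_eq_left.2 (fun ω hω i hi => ?_)
        rw [hω i (by omega), hc i hi]
      rw [e1, e2]
      refine hPE n _ _ ⟨?_, fun u v => ?_⟩
      · simp [splice, hpp.1, hc 0 (by omega)]
      · obtain ⟨d, h1, h2⟩ := stk_splice (p := p) (x := c) (N := N)
          (by rw [hN, hc N le_rfl]) u n hn
        rw [transCount_eq, transCount_eq, h1, h2, List.count_append, List.count_append,
          stk_congr hc u, ← transCount_eq, ← transCount_eq, hpp.2]
    · have e1 : splice N p' ⁻¹' cyl n c ∩ cyl N p = ∅ := by
        refine Set.eq_empty_of_forall_notMem ?_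
        rintro ω ⟨h1, -⟩
        refine hc fun i hi => ?_
        have := h1 i (by omega)
        simpa [splice, hi] using this.symm
      have e2 : cyl n c ∩ cyl N p' = ∅ := by
        refine Set.eq_empty_of_forall_notMem ?_
        rintro ω ⟨h1, h2⟩
        refine hc fun i hi => ?_
        rw [← h1 i (by omega), h2 i hi]
      rw [e1, e2]
  · rw [Measure.map_apply (meas_splice N p') MeasurableSet.univ]
    simp only [preimage_univ, Measure.restrict_apply_univ]
    exact hPE N p p' hpp

/-- the event with prescribed stacks on `W` -/
def EV (A : Set (ℕ → S)) (B W : Finset S) (N : ℕ) (t : W → List S) : Set (ℕ → S) :=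
  {x | x ∈ A ∧ HB B W x ∧ RN W N x ∧ ∀ v : W, stack x v = t v}

lemma swap_le_N (μ : Measure (ℕ → S)) [IsFiniteMeasure μ] (hPE : PartiallyExchangeable μ)
    {A : Set (ℕ → S)} (hATr : ∀ x ∈ A, Tr x)
    (hA : ∀ x ∈ A, ∀ y : ℕ → S, InfEquiv x y → y ∈ A) (B W : Finset S) (N : ℕ)
    (t t' : W → List S) (htt : ∀ v, (t' v).Perm (t v)) (hac : Acyc t') :
    μ (EV A B W N t) ≤ μ (EV A B W N t') := by
  set I := {c : Fin (N + 1) → S // ((EV A B W N t) ∩ cyl N (pext c)).Nonempty} with hI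
  have hex : ∀ c : I, ∃ p' : ℕ → S, p' 0 = pext c.1 0 ∧ p' N = pext c.1 N ∧
      (∀ v : W, stk p' N v = t' v) ∧ ∀ v ∉ W, stk p' N v = stk (pext c.1) N v := by
    rintro ⟨c, x, hx, hc⟩
    obtain ⟨p', a, b, d, e⟩ := swap_exists (hATr x hx.1) hx.2.1.2.1 hx.2.2.1 t'
      (fun v => by rw [hx.2.2.2 v]; exact htt v) hac
    refine ⟨p', by rw [a, hc 0 (by omega)], by rw [b, hc N le_rfl], d, fun v hv => ?_⟩
    rw [e v hv]; exact stk_congr hc v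
  choose p' h0 hN hpt hpn using hex
  have htc : ∀ c : I, ∀ v : W, stk (pext c.1) N v = t v := by
    rintro ⟨c, x, hx, hc⟩ v
    rw [← stk_congr hc, ← hx.2.2.2 v]
    have hst : stack x v = stk x N v := stack_eq (fun i hi e => (hx.2.2.1 i hi).1 (e ▸ v.2))
    exact hst.symm
  have hinj : Function.Injective (fun c : I => pres N (p' c)) := by
    intro c d hcd
    simp only at hcd
    have hcd' : ∀ i ≤ N, p' c i = p' d i := fun i hi => by
      rw [pres_eq_iff.1 hcd i hi, pext_pres N _ i hi]
    have := stk_unique (x := pext c.1) (y := pext d.1) (n := N)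
      (by rw [← h0, ← h0]; exact hcd' 0 (by omega))
      (fun v => by
        by_cases hv : v ∈ W
        · have h1 := htc c ⟨v, hv⟩
          have h2 := htc d ⟨v, hv⟩
          simp only at h1 h2
          rw [h1, h2]
        · rw [← hpn c v hv, ← hpn d v hv]; exact stk_congr hcd' v)
    ext1
    have e1 : pres N (pext d.1) = c.1 := pres_eq_iff.2 (fun i hi => (this i hi).symm)
    have e2 : pres N (pext d.1) = d.1 := pres_eq_iff.2 (fun i hi => rfl)
    rw [← e1, e2]
  have hle : ∀ c : I, μ (EV A B W N t ∩ cyl N (pext c.1)) ≤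
      μ (EV A B W N t' ∩ cyl N (p' c)) := by
    intro c
    have hfe : FinEquiv (pext c.1) (p' c) N := by
      refine finEquiv_of_stk (h0 c).symm (fun v => ?_)
      by_cases hv : v ∈ W
      · have h1 := htc c ⟨v, hv⟩
        have h2 := hpt c ⟨v, hv⟩
        simp only at h1 h2
        rw [h1, h2]; exact (htt _).symm
      · rw [hpn c v hv]
    have hm := map_splice μ hPE hfe (hN c).symm
    calc μ (EV A B W N t ∩ cyl N (pext c.1))
        ≤ μ (splice N (p' c) ⁻¹' (EV A B W N t') ∩ cyl N (pext c.1)) := by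
          refine measure_mono ?_
          rintro x ⟨hx, hc⟩
          refine ⟨?_, hc⟩
          obtain ⟨a1, a2, a3, a4, a5, a6⟩ := swap_props (hATr x hx.1) hx.2.1 hx.2.2.1 t'
            (fun v => by rw [hx.2.2.2 v]; exact htt v)
            (by rw [h0 c, hc 0 (by omega)]) (by rw [hN c, hc N le_rfl]) (hpt c)
            (fun v hv => by rw [hpn c v hv]; exact (stk_congr hc v).symm)
          exact ⟨hA x hx.1 _ a3, a4, a5, a6⟩
      _ ≤ (μ.restrict (cyl N (pext c.1))) (splice N (p' c) ⁻¹' (EV A B W N t')) :=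
          Measure.le_restrict_apply _ _
      _ ≤ ((μ.restrict (cyl N (pext c.1))).map (splice N (p' c))) (EV A B W N t') :=
          Measure.le_map_apply (meas_splice N _).aemeasurable _
      _ = μ (EV A B W N t' ∩ cyl N (p' c)) := by
          rw [hm, Measure.restrict_apply' (meas_cyl _ _)]
  have hdisj : ∀ c : Fin (N+1) → S, ∀ d, c ≠ d → Disjoint (cyl N (pext c)) (cyl N (pext d)) := by
    intro c d hcd
    rw [Set.disjoint_left]
    intro x h1 h2
    exact hcd ((pres_eq_iff.2 h1).symm.trans (pres_eq_iff.2 h2))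
  calc μ (EV A B W N t) ≤ μ (⋃ c : I, EV A B W N t ∩ cyl N (pext c.1)) := by
        refine measure_mono fun x hx => ?_
        have hxc : x ∈ cyl N (pext (pres N x)) := fun i hi => (pext_pres N x i hi).symm
        exact mem_iUnion.2 ⟨⟨pres N x, x, hx, hxc⟩, hx, hxc⟩
    _ ≤ ∑' c : I, μ (EV A B W N t ∩ cyl N (pext c.1)) := measure_iUnion_le _
    _ ≤ ∑' c : I, μ (EV A B W N t' ∩ cyl N (p' c)) := ENNReal.tsum_le_tsum hle
    _ = ∑' c : I, μ (EV A B W N t' ∩ cyl N (pext (pres N (p' c)))) := by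
        refine tsum_congr fun c => ?_
        rw [cyl_congr (fun i hi => pext_pres N (p' c) i hi)]
    _ ≤ ∑' d : Fin (N+1) → S, μ (EV A B W N t' ∩ cyl N (pext d)) :=
        ENNReal.tsum_comp_le_tsum_of_injective hinj
          (fun d => μ (EV A B W N t' ∩ cyl N (pext d)))
    _ = ∑' d : Fin (N+1) → S, μ.restrict (EV A B W N t') (cyl N (pext d)) := by
        refine tsum_congr fun d => ?_
        rw [Measure.restrict_apply (meas_cyl _ _), Set.inter_comm]
    _ = μ.restrict (EV A B W N t') (⋃ d : Fin (N+1) → S, cyl N (pext d)) :=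
        (measure_iUnion (fun c d hcd => hdisj c d hcd) (fun d => meas_cyl _ _)).symm
    _ ≤ μ (EV A B W N t') := (measure_mono (subset_univ _)).trans (by simp)

/-- the event with prescribed stacks on `W`, without the time constraint -/
def FV (A : Set (ℕ → S)) (B W : Finset S) (t : W → List S) : Set (ℕ → S) :=
  {x | x ∈ A ∧ HB B W x ∧ ∀ v : W, stack x v = t v}

lemma swap_le (μ : Measure (ℕ → S)) [IsFiniteMeasure μ] (hPE : PartiallyExchangeable μ)
    {A : Set (ℕ → S)} (hATr : ∀ x ∈ A, Tr x)
    (hA : ∀ x ∈ A, ∀ y : ℕ → S, InfEquiv x y → y ∈ A) (B W : Finset S)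
    (t t' : W → List S) (htt : ∀ v, (t' v).Perm (t v)) (hac : Acyc t') :
    μ (FV A B W t) ≤ μ (FV A B W t') := by
  have h1 : ∀ t : W → List S, FV A B W t = ⋃ N, EV A B W N t := by
    intro t
    ext x
    simp only [mem_iUnion]
    constructor
    · rintro ⟨a, b, c⟩
      obtain ⟨N, hN⟩ := RN_exists (hATr x a) W
      exact ⟨N, a, b, hN, c⟩
    · rintro ⟨N, a, b, c, d⟩
      exact ⟨a, b, d⟩
  have hm : ∀ t : W → List S, Monotone (fun N => EV A B W N t) := by
    rintro t N N' h x ⟨a, b, c, d⟩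
    exact ⟨a, b, RN_mono c h, d⟩
  rw [h1, h1, (hm t).measure_iUnion, (hm t').measure_iUnion]
  exact iSup_mono (fun N => swap_le_N μ hPE hATr hA B W N t t' htt hac)

lemma meas_FV {A : Set (ℕ → S)} (hA : MeasurableSet A) (B W : Finset S) (t : W → List S) :
    MeasurableSet (FV A B W t) :=
  mand hA (mand (meas_HB B W) (mall fun v => meas_stack_eq _ _))

end Aux3

section Aux4
open scoped Classical

/-- a partial self-map without cycles -/
def AcF {ι : Type} (f : ι → Option ι) : Prop := ∃ r : ι → ℕ, ∀ v w, f v = some w → r w < r v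

/-- Laplacian of a partial self-map -/
noncomputable def lapF {ι : Type} (f : ι → Option ι) : Matrix ι ι ℝ :=
  fun v y => (if v = y then 1 else 0) - (if f v = some y then 1 else 0)

lemma det_lapF_of_acF {ι : Type} [Fintype ι] (f : ι → Option ι) (h : AcF f) :
    (lapF f).det = 1 := by
  obtain ⟨r, hr⟩ := h
  have hb : Matrix.BlockTriangular (lapF f) (fun v => OrderDual.toDual (r v)) := by
    intro v y hvy
    have hvy' : r v < r y := hvy
    unfold lapF
    rw [if_neg (by rintro rfl; omega), if_neg (fun e => by have := hr v y e; omega)]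
    simp
  rw [hb.det]
  refine Finset.prod_eq_one fun a _ => ?_
  have : (lapF f).toSquareBlock (fun v => OrderDual.toDual (r v)) a = 1 := by
    ext v y
    rw [Matrix.toSquareBlock_def, Matrix.of_apply, Matrix.one_apply]
    unfold lapF
    have e : r v.1 = r y.1 := by
      have h1 := v.2
      have h2 := y.2
      exact OrderDual.toDual.injective (h1.trans h2.symm)
    rw [if_neg (c := f v.1 = some y.1) (fun e' => by have := hr _ _ e'; omega)]
    simp [Subtype.ext_iff]
  rw [this, Matrix.det_one]

lemma det_lapF_of_not {ι : Type} [Fintype ι] (f : ι → Option ι) (h : ¬ AcF f) :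
    (lapF f).det = 0 := by
  set st : Option ι → Option ι := fun o => o.bind f with hst
  set L : ι → Prop := fun v => ∃ n, st^[n] (some v) = none with hL
  have hstep : ∀ v w, f v = some w → ∀ n, st^[n+1] (some v) = st^[n] (some w) := by
    intro v w hvw n
    rw [Function.iterate_succ_apply]
    simp [hst, hvw]
  have hLstep : ∀ v w, f v = some w → (L v ↔ L w) := by
    intro v w hvw
    constructor
    · rintro ⟨n, hn⟩
      rcases n with _ | n
      · simp at hn
      · exact ⟨n, by rw [← hstep v w hvw]; exact hn⟩
    · rintro ⟨n, hn⟩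
      exact ⟨n+1, by rw [hstep v w hvw]; exact hn⟩
  rw [← Matrix.exists_mulVec_eq_zero_iff]
  refine ⟨fun v => if L v then 0 else 1, ?_, ?_⟩
  · intro h0
    refine h ?_
    have hall : ∀ v, L v := by
      intro v
      have := congrFun h0 v
      by_contra hc
      simp [hc] at this
    refine ⟨fun v => Nat.find (hall v), fun v w hvw => ?_⟩
    have hs := Nat.find_spec (hall v)
    have hpos : Nat.find (hall v) ≠ 0 := by
      intro e
      rw [e] at hs
      simp at hs
    obtain ⟨k, hk⟩ := Nat.exists_eq_succ_of_ne_zero hpos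
    rw [hk, Nat.succ_eq_add_one, hstep v w hvw] at hs
    have := Nat.find_min' (hall w) hs
    change Nat.find (hall w) < Nat.find (hall v)
    omega
  · funext v
    simp only [Matrix.mulVec, dotProduct, lapF, sub_mul, Finset.sum_sub_distrib, ite_mul, one_mul,
      zero_mul, Finset.sum_ite_eq, Finset.mem_univ, if_true, Pi.zero_apply]
    rcases hf : f v with _ | w
    · have : L v := ⟨1, by simp [hst, hf]⟩
      simp [this]
    · simp only [Option.some.injEq, Finset.sum_ite_eq, Finset.mem_univ, if_true]
      have := hLstep v w hf
      simp [this]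

/-- matrix tree theorem -/
lemma mtt {ι κ : Type} [Fintype ι] (Q : ι → Finset κ) (e : κ → Option ι) :
    (Matrix.of fun v y => ∑ k ∈ Q v, ((if v = y then (1:ℝ) else 0) -
      (if e k = some y then 1 else 0))).det =
      (((Fintype.piFinset Q).filter (fun φ => AcF (fun v => e (φ v)))).card : ℝ) := by
  have h1 : (Matrix.of fun v y => ∑ k ∈ Q v, ((if v = y then (1:ℝ) else 0) -
      (if e k = some y then 1 else 0))).det =
      Matrix.detRowAlternating.toMultilinearMap (fun v => ∑ k ∈ Q v, (fun y : ι =>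
        ((if v = y then (1:ℝ) else 0) - (if e k = some y then 1 else 0)))) := by
    change _ = Matrix.det _
    congr 1
    ext v y
    simp [Finset.sum_apply]
  rw [h1, MultilinearMap.map_sum_finset]
  have h2 : ∀ φ : ι → κ, Matrix.detRowAlternating.toMultilinearMap (fun v => (fun y : ι =>
        ((if v = y then (1:ℝ) else 0) - (if e (φ v) = some y then 1 else 0)))) =
        if AcF (fun v => e (φ v)) then (1:ℝ) else 0 := by
    intro φ
    change (lapF (fun v => e (φ v))).det = _
    split_ifs with h
    · exact det_lapF_of_acF _ h
    · exact det_lapF_of_not _ h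
  rw [Finset.sum_congr rfl (fun φ _ => h2 φ), Finset.sum_boole]

lemma card_last (s : List S) (y : S) :
    (s.permutations.toFinset.filter (fun l => l.getLast? = some y)).card * s.length =
      s.permutations.toFinset.card * s.count y := by
  set P := s.permutations.toFinset with hP
  have hmem : ∀ l, l ∈ P ↔ l.Perm s := fun l => by simp [hP]
  have h1 : ∀ k, (P.filter (fun l => (l.rotate k).getLast? = some y)).card =
      (P.filter (fun l => l.getLast? = some y)).card := by
    intro k
    refine Finset.card_bij (fun l _ => l.rotate k) ?_ ?_ ?_
    · intro l hl
      rw [Finset.mem_filter, hmem] at hl ⊢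
      exact ⟨(List.rotate_perm l k).trans hl.1, hl.2⟩
    · intro l _ l' _ h
      exact List.rotate_injective k h
    · intro l hl
      rw [Finset.mem_filter, hmem] at hl
      obtain ⟨l', hl'⟩ : ∃ l', List.rotate l' k = l := by
        refine ⟨l.rotate (l.length - k % l.length), ?_⟩
        rw [List.rotate_rotate]
        rcases Nat.eq_zero_or_pos l.length with h0 | h0
        · rw [List.length_eq_zero_iff] at h0; subst h0; simp
        · rw [← List.rotate_mod]
          have : (l.length - k % l.length + k) % l.length = 0 := by
            have h1 := Nat.mod_lt k h0
            have h2 := Nat.div_add_mod k l.length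
            have : l.length - k % l.length + k = l.length * (k / l.length + 1) := by
              rw [Nat.mul_add]; omega
            rw [this]; simp
          rw [this, List.rotate_zero]
      refine ⟨l', ?_, hl'⟩
      rw [Finset.mem_filter, hmem, hl']
      refine ⟨?_, hl.2⟩
      exact (List.rotate_perm l' k).symm.trans (hl' ▸ hl.1)
  have h2 : ∀ l ∈ P, ((Finset.range s.length).filter
      (fun k => (l.rotate k).getLast? = some y)).card = s.count y := by
    intro l hl
    rw [hmem] at hl
    rw [← hl.length_eq, ← hl.count_eq]
    -- positions
    have : ∀ n, n ≤ l.length → ((Finset.range n).filter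
      (fun k => (l.rotate k).getLast? = some y)).card =
        (((l.rotate (l.length - 1)).take n)).count y := by
      intro n
      induction n with
      | zero => simp
      | succ n ih =>
        intro hn
        rw [Finset.range_add_one, Finset.filter_insert]
        have hlen : (l.rotate (l.length - 1)).length = l.length := List.length_rotate _ _
        rw [List.take_add_one, List.count_append, ← ih (by omega)]
        have e1 : (l.rotate n).getLast? = (l.rotate (l.length - 1))[n]? := by
          rw [List.getLast?_eq_getElem?, List.length_rotate,
            List.getElem?_rotate (by omega), List.getElem?_rotate (by omega)]
          congr 2
          omega
        rw [← e1]
        split_ifs with h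
        · rw [Finset.card_insert_of_notMem (by simp), h]
          simp
        · rcases ho : (l.rotate n).getLast? with _ | z
          · simp
          · have : z ≠ y := fun e => h (by rw [ho, e])
            simp [this]
    rw [this l.length le_rfl, List.take_of_length_le (by simp)]
    exact (List.rotate_perm _ _).count_eq y
  have h3 : ∑ k ∈ Finset.range s.length,
      (P.filter (fun l => (l.rotate k).getLast? = some y)).card =
      ∑ l ∈ P, ((Finset.range s.length).filter
        (fun k => (l.rotate k).getLast? = some y)).card := by
    simp only [Finset.card_filter]
    exact Finset.sum_comm
  rw [Finset.sum_congr rfl (fun k _ => h1 k), Finset.sum_congr rfl h2] at h3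
  simp at h3
  rw [mul_comm, h3]

end Aux4

section Aux5
open scoped Classical

/-- powers of a nonnegative kernel -/
noncomputable def Pn (P : S → S → ℝ≥0∞) : ℕ → S → S → ℝ≥0∞
  | 0 => fun w u => if w = u then 1 else 0
  | k + 1 => fun w u => ∑' v, P w v * Pn P k v u

/-- Green function of a nonnegative kernel -/
noncomputable def Gr (P : S → S → ℝ≥0∞) (w u : S) : ℝ≥0∞ := ∑' k, Pn P k w u

lemma Gr_eq (P : S → S → ℝ≥0∞) (w u : S) :
    Gr P w u = (if w = u then 1 else 0) + ∑' v, P w v * Gr P v u := by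
  unfold Gr
  rw [tsum_eq_zero_add' ENNReal.summable]
  congr 1
  simp only [Pn, ← ENNReal.tsum_mul_left]
  exact ENNReal.tsum_comm

lemma Pn_mono {P P' : S → S → ℝ≥0∞} (h : ∀ v w, P v w ≤ P' v w) (k : ℕ) (w u : S) :
    Pn P k w u ≤ Pn P' k w u := by
  induction k generalizing w with
  | zero => exact le_rfl
  | succ k ih => exact ENNReal.tsum_le_tsum fun v => mul_le_mul' (h w v) (ih v)

lemma Gr_mono {P P' : S → S → ℝ≥0∞} (h : ∀ v w, P v w ≤ P' v w) (w u : S) :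
    Gr P w u ≤ Gr P' w u := ENNReal.tsum_le_tsum fun k => Pn_mono h k w u

/-- restriction of a kernel to `W` -/
noncomputable def PW (W : Finset S) (P : S → S → ℝ≥0∞) (w v : S) : ℝ≥0∞ :=
  if w ∈ W ∧ v ∈ W then P w v else 0

lemma PW_le (W : Finset S) (P : S → S → ℝ≥0∞) (w v : S) : PW W P w v ≤ P w v := by
  unfold PW; split_ifs <;> simp

lemma PW_mono {W W' : Finset S} (h : W ≤ W') (P : S → S → ℝ≥0∞) (w v : S) :
    PW W P w v ≤ PW W' P w v := by
  unfold PW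
  split_ifs with h1 h2
  · exact le_rfl
  · exact absurd ⟨h h1.1, h h1.2⟩ h2
  · simp
  · simp

/-- one-step probabilities of the walk on the multigraph of a transient sequence -/
noncomputable def pk (x : ℕ → S) (w v : S) : ℝ≥0∞ :=
  ((stack x w).count v : ℝ≥0∞) / ((stack x w).length : ℝ≥0∞)

lemma tr_balance {x : ℕ → S} (hx : Tr x) (y : S) :
    (∑' v, ((stack x v).count y : ℝ≥0∞)) + (if y = x 0 then 1 else 0) ≤
      ((stack x y).length : ℝ≥0∞) := by
  rw [ENNReal.tsum_eq_iSup_sum, ENNReal.iSup_add]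
  refine iSup_le fun K => ?_
  obtain ⟨N, hN⟩ := hx.finset (insert y K)
  have hb := stk_balance x (K ∪ (Finset.range N).image x) N (fun i hi => by
    rw [Finset.mem_union]; right
    exact Finset.mem_image.2 ⟨i, Finset.mem_range.2 hi, rfl⟩) y
  rw [if_neg (c := y = x N) (fun e => hN N le_rfl (e ▸ Finset.mem_insert_self _ _))] at hb
  have hst : ∀ v ∈ insert y K, stack x v = stk x N v := fun v hv =>
    stack_eq (fun i hi e => hN i hi (e ▸ hv))
  rw [hst y (Finset.mem_insert_self _ _)]
  have h2 : ∑ v ∈ K, (stack x v).count y ≤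
      ∑ v ∈ K ∪ (Finset.range N).image x, (stk x N v).count y := by
    rw [Finset.sum_congr rfl (fun v hv => by rw [hst v (Finset.mem_insert_of_mem hv)])]
    exact Finset.sum_le_sum_of_subset Finset.subset_union_left
  have h3 : ∑ v ∈ K, (stack x v).count y + (if y = x 0 then 1 else 0) ≤ (stk x N y).length := by
    omega
  have h4 : ((∑ v ∈ K, (stack x v).count y + (if y = x 0 then 1 else 0) : ℕ) : ℝ≥0∞) ≤
      ((stk x N y).length : ℝ≥0∞) := by exact_mod_cast h3
  push_cast at h4
  exact h4

lemma Gr_x0 {x : ℕ → S} (hx : Tr x) (u : S) :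
    Gr (pk x) (x 0) u ≤ ((stack x u).length : ℝ≥0∞) := by
  set d : S → ℝ≥0∞ := fun v => ((stack x v).length : ℝ≥0∞) with hd
  set c : ℕ → ℝ≥0∞ := fun n => ∑' v, d v * Pn (pk x) n v u with hc
  have hdp : ∀ w v, d w * pk x w v = ((stack x w).count v : ℝ≥0∞) := by
    intro w v
    simp only [hd, pk]
    by_cases h0 : (stack x w).length = 0
    · rw [List.length_eq_zero_iff] at h0
      simp [h0]
    · exact ENNReal.mul_div_cancel (by exact_mod_cast h0) (ENNReal.natCast_ne_top _)
  have hstep : ∀ n, Pn (pk x) n (x 0) u + c (n + 1) ≤ c n := by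
    intro n
    have e1 : c (n+1) = ∑' v, (∑' w, ((stack x w).count v : ℝ≥0∞)) * Pn (pk x) n v u := by
      simp only [hc, Pn, ← ENNReal.tsum_mul_left, ← ENNReal.tsum_mul_right]
      rw [ENNReal.tsum_comm]
      refine tsum_congr fun v => tsum_congr fun w => ?_
      rw [← hdp, mul_assoc]
    have e2 : Pn (pk x) n (x 0) u =
        ∑' v, (if v = x 0 then 1 else 0) * Pn (pk x) n v u := by
      rw [tsum_eq_single (x 0) (fun v hv => by simp [hv])]; simp
    rw [e1, e2, ← ENNReal.tsum_add]
    refine ENNReal.tsum_le_tsum fun v => ?_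
    rw [← add_mul, add_comm]
    exact mul_le_mul' (tr_balance hx v) le_rfl
  have hsum : ∀ n, ∑ k ∈ Finset.range n, Pn (pk x) k (x 0) u + c n ≤ c 0 := by
    intro n
    induction n with
    | zero => simp
    | succ n ih =>
      rw [Finset.sum_range_succ, add_assoc]
      exact (add_le_add le_rfl (hstep n)).trans ih
  have hc0 : c 0 = d u := by
    simp only [hc, Pn]
    rw [tsum_eq_single u (fun v hv => by simp [hv])]; simp
  unfold Gr
  rw [ENNReal.tsum_eq_iSup_nat]
  refine iSup_le fun n => ?_
  change _ ≤ d u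
  rw [← hc0]
  exact le_self_add.trans (hsum n)

lemma Gr_fin {x : ℕ → S} (hx : Tr x) (w u : S) : Gr (pk x) w u < ⊤ := by
  have hvis : ∀ i, Gr (pk x) (x i) u < ⊤ := by
    intro i
    induction i with
    | zero => exact (Gr_x0 hx u).trans_lt (ENNReal.natCast_lt_top _)
    | succ i ih =>
      rw [Gr_eq] at ih
      have h1 := (le_add_self.trans_lt ih)
      have h2 := (ENNReal.le_tsum (f := fun v => pk x (x i) v * Gr (pk x) v u) (x (i+1))).trans_lt h1
      have h3 : pk x (x i) (x (i+1)) ≠ 0 := by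
        unfold pk
        rw [Ne, ENNReal.div_eq_zero_iff, not_or]
        refine ⟨?_, ENNReal.natCast_ne_top _⟩
        have := List.count_pos_iff.2 (mem_stack_of hx i)
        exact_mod_cast this.ne'
      rcases ENNReal.mul_lt_top_iff.1 h2 with h | h | h
      · exact h.2
      · exact absurd h h3
      · rw [h]; simp
  by_cases h : ∃ i, x i = w
  · obtain ⟨i, rfl⟩ := h
    exact hvis i
  · have hs : stack x w = [] := by
      rw [List.eq_nil_iff_forall_not_mem]
      intro v hv
      obtain ⟨i, hi, _⟩ := mem_stack hv
      exact h ⟨i, hi⟩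
    rw [Gr_eq]
    have : ∀ v, pk x w v = 0 := fun v => by simp [pk, hs]
    simp only [this, zero_mul, tsum_zero, add_zero]
    split_ifs <;> simp

/-- real Green function of the walk killed outside of `W` -/
noncomputable def gw (x : ℕ → S) (W : Finset S) (w u : S) : ℝ := (Gr (PW W (pk x)) w u).toReal

lemma gw_lim {x : ℕ → S} (hx : Tr x) (w u : S) :
    ∃ g : ℝ, Tendsto (fun W => gw x W w u) atTop (nhds g) := by
  have hmono : Monotone (fun W : Finset S => Gr (PW W (pk x)) w u) :=
    fun W W' h => Gr_mono (PW_mono h _) w u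
  have := tendsto_atTop_iSup hmono
  refine ⟨_, (ENNReal.tendsto_toReal ?_).comp this⟩
  refine ne_top_of_le_ne_top (Gr_fin hx w u).ne (iSup_le fun W => Gr_mono (PW_le W _) w u)

lemma gw_eq {x : ℕ → S} (hx : Tr x) (W : Finset S) (w u : W) :
    gw x W w u = (if w = u then 1 else 0) + ∑ v : W, (pk x w v).toReal * gw x W v u := by
  have hfin : ∀ v, Gr (PW W (pk x)) v u ≠ ⊤ := fun v =>
    ne_top_of_le_ne_top (Gr_fin hx v u).ne (Gr_mono (PW_le W _) v u)
  have hpk : ∀ v, pk x w v ≠ ⊤ := by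
    intro v
    unfold pk
    by_cases h0 : (stack x w).length = 0
    · rw [List.length_eq_zero_iff] at h0; simp [h0]
    · exact ENNReal.div_ne_top (ENNReal.natCast_ne_top _) (by exact_mod_cast h0)
  have e : ∑' v, PW W (pk x) w v * Gr (PW W (pk x)) v u =
      ∑ v : W, pk x w v * Gr (PW W (pk x)) v u := by
    rw [tsum_eq_sum (s := W) (fun v hv => by simp [PW, hv])]
    rw [← Finset.sum_coe_sort]
    refine Finset.sum_congr rfl fun v _ => ?_
    simp [PW]
  have hterm : ∀ v ∈ (Finset.univ : Finset W), pk x w v * Gr (PW W (pk x)) v u ≠ ⊤ :=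
    fun v _ => ENNReal.mul_ne_top (hpk v) (hfin v)
  unfold gw
  rw [Gr_eq, e, ENNReal.toReal_add (by split_ifs <;> simp) (ENNReal.sum_ne_top.2 hterm),
    ENNReal.toReal_sum hterm]
  simp only [ENNReal.toReal_mul, Subtype.ext_iff]
  congr 1
  split_ifs <;> simp

lemma gw_zero (x : ℕ → S) {W : Finset S} {w u : S} (hw : w ∉ W) (hu : u ∈ W) :
    gw x W w u = 0 := by
  unfold gw
  rw [Gr_eq]
  have : w ≠ u := fun e => hw (e ▸ hu)
  simp [PW, hw, this]

end Aux5

section Aux6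
open scoped Classical

lemma transNum_eq {x : ℕ → S} (hx : Tr x) (v w : S) :
    transNum x v w = ((stack x v).count w : ℕ∞) := by
  obtain ⟨N, hN⟩ := hx v
  rw [stack_eq hN, ← transCount_eq]
  unfold transNum transCount
  have : {i : ℕ | x i = v ∧ x (i + 1) = w} = {i : ℕ | i < N ∧ x i = v ∧ x (i + 1) = w} := by
    ext i
    simp only [Set.mem_ofPred_eq]
    constructor
    · intro h
      refine ⟨?_, h⟩
      by_contra hc
      exact hN i (by omega) h.1
    · exact fun h => h.2
  rw [this]
  refine (Set.Finite.cast_ncard_eq ?_).symm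
  exact (Set.finite_lt_nat N).subset (fun i hi => hi.1)

/-- `t` has the row counts prescribed by the transition numbers of `x` -/
def CC (W : Finset S) (x : ℕ → S) (t : W → List S) : Prop :=
  ∀ v : W, ∀ w : S, ((t v).count w : ℕ∞) = transNum x v w

/-- numerator -/
noncomputable def Nm (U : Finset S) (τ : S → List S) (W : Finset S) (x : ℕ → S) : ℝ≥0∞ :=
  ∑' t : W → List S, if CC W x t ∧ Acyc t ∧ ∀ v : W, (v : S) ∈ U → t v = τ v then 1 else 0

/-- denominator -/
noncomputable def Dn (W : Finset S) (x : ℕ → S) : ℝ≥0∞ :=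
  ∑' t : W → List S, if CC W x t ∧ Acyc t then 1 else 0

/-- conditional probability of the stacks `τ` on `U` -/
noncomputable def qW (U : Finset S) (τ : S → List S) (W : Finset S) (x : ℕ → S) : ℝ≥0∞ :=
  Nm U τ W x / Dn W x

lemma CC_iff {x : ℕ → S} (hx : Tr x) {W : Finset S} {t : W → List S} :
    CC W x t ↔ ∀ v : W, (t v).Perm (stack x v) := by
  unfold CC
  refine forall_congr' fun v => ?_
  rw [List.perm_iff_count]
  refine forall_congr' fun w => ?_
  rw [transNum_eq hx]
  exact_mod_cast Iff.rfl

/-- last element, if in `W` -/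
noncomputable def lastW (W : Finset S) (l : List S) : Option W :=
  l.getLast?.bind (fun w => if h : w ∈ W then some ⟨w, h⟩ else none)

lemma lastW_eq_some {W : Finset S} {l : List S} {w : W} :
    lastW W l = some w ↔ l.getLast? = some (w : S) := by
  unfold lastW
  rcases h : l.getLast? with _ | z
  · simp
  · simp only [Option.bind_some, Option.some.injEq]
    split_ifs with hz
    · simp [Subtype.ext_iff]
    · simp only [reduceCtorEq, false_iff]
      rintro rfl
      exact hz w.2

lemma acyc_iff {W : Finset S} {t : W → List S} : Acyc t ↔ AcF (fun v => lastW W (t v)) := by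
  unfold Acyc AcF
  simp only [lastW_eq_some]

lemma tsum_ind {α : Type} (F : Finset α) (P : α → Prop) [DecidablePred P] (h : ∀ a, P a ↔ a ∈ F) :
    (∑' a, if P a then (1 : ℝ≥0∞) else 0) = (F.card : ℝ≥0∞) := by
  rw [tsum_eq_sum (s := F) (fun a ha => by rw [if_neg]; rwa [h])]
  rw [Finset.sum_congr rfl (fun a ha => if_pos ((h a).2 ha))]
  simp

lemma block_det {W U : Finset S} (hUW : U ⊆ W) (K : Matrix W W ℝ) (F : S → S → ℝ)
    (hoff : ∀ v y : W, (v : S) ∉ U → K v y = if v = y then 1 else 0)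
    (hon : ∀ u u' : W, (u : S) ∈ U → (u' : S) ∈ U → K u u' = F u u') :
    K.det = (Matrix.of fun u u' : U => F u u').det := by
  rw [Matrix.twoBlockTriangular_det K (fun v : W => (v : S) ∈ U) (fun i hi j hj => by
    rw [hoff i j hi, if_neg]; rintro rfl; exact hi hj)]
  have h2 : K.toSquareBlockProp (fun v : W => ¬ (v : S) ∈ U) = 1 := by
    ext v y
    rw [Matrix.toSquareBlockProp_def, Matrix.of_apply, hoff _ _ v.2, Matrix.one_apply]
    by_cases h : v = y
    · subst h; simp
    · have h' : v.1 ≠ y.1 := fun e => h (Subtype.ext e)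
      rw [if_neg h, if_neg h']
  have h1 : K.toSquareBlockProp (fun v : W => (v : S) ∈ U) =
      (Matrix.of fun u u' : U => F u u').submatrix
        (Equiv.subtypeSubtypeEquivSubtype (p := fun a => a ∈ W) (q := fun a => a ∈ U)
          (fun {a} ha => hUW ha))
        (Equiv.subtypeSubtypeEquivSubtype (p := fun a => a ∈ W) (q := fun a => a ∈ U)
          (fun {a} ha => hUW ha)) := by
    ext v y
    rw [Matrix.toSquareBlockProp_def, Matrix.of_apply, hon _ _ v.2 y.2]
    rfl
  rw [h2, Matrix.det_one, mul_one, h1]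
  convert Matrix.det_submatrix_equiv_self _ _

/-- limiting matrix entries -/
noncomputable def kent (x : ℕ → S) (τ : S → List S) (W : Finset S) (u u' : S) : ℝ :=
  ((stack x u).permutations.toFinset.card : ℝ)⁻¹ *
    (gw x W u u' - ((τ u).getLast?).elim 0 (fun w => gw x W w u'))

lemma Nm_card {x : ℕ → S} (hx : Tr x) (U W : Finset S) (τ : S → List S) :
    Nm U τ W x = (((Fintype.piFinset (fun v : W => if (v : S) ∈ U then
      (stack x v).permutations.toFinset.filter (fun l => l = τ v) else
        (stack x v).permutations.toFinset)).filter
          (fun φ => AcF (fun v => lastW W (φ v)))).card : ℝ≥0∞) := by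
  unfold Nm
  refine tsum_ind _ _ fun t => ?_
  rw [Finset.mem_filter, Fintype.mem_piFinset, CC_iff hx, ← acyc_iff]
  constructor
  · rintro ⟨a, b, c⟩
    refine ⟨fun v => ?_, b⟩
    split_ifs with h
    · rw [Finset.mem_filter]
      exact ⟨by simp [a v], c v h⟩
    · simp [a v]
  · rintro ⟨a, b⟩
    refine ⟨fun v => ?_, b, fun v hv => ?_⟩
    · have := a v
      split_ifs at this with h
      · simp at this; exact this.1
      · simpa using this
    · have := a v
      rw [if_pos hv] at this
      simp at this; exact this.2

lemma Dn_card {x : ℕ → S} (hx : Tr x) (W : Finset S) :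
    Dn W x = (((Fintype.piFinset (fun v : W =>
        (stack x v).permutations.toFinset)).filter
          (fun φ => AcF (fun v => lastW W (φ v)))).card : ℝ≥0∞) := by
  unfold Dn
  refine tsum_ind _ _ fun t => ?_
  rw [Finset.mem_filter, Fintype.mem_piFinset, CC_iff hx, ← acyc_iff]
  simp

lemma Dn_ne {x : ℕ → S} (hx : Tr x) (W : Finset S) : Dn W x ≠ 0 ∧ Dn W x ≠ ⊤ := by
  rw [Dn_card hx]
  refine ⟨?_, ENNReal.natCast_ne_top _⟩
  have : (fun v : W => stack x v) ∈ ((Fintype.piFinset (fun v : W =>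
        (stack x v).permutations.toFinset)).filter
          (fun φ => AcF (fun v => lastW W (φ v)))) := by
    rw [Finset.mem_filter, Fintype.mem_piFinset, ← acyc_iff]
    exact ⟨fun v => by simp, acyc_stack hx W⟩
  exact_mod_cast (Finset.card_pos.2 ⟨_, this⟩).ne'

lemma qW_eq {x : ℕ → S} (hx : Tr x) {U W : Finset S} (hUW : U ⊆ W) (τ : S → List S)
    (hτ : ∀ u ∈ U, (τ u).Perm (stack x u)) :
    qW U τ W x = ENNReal.ofReal (Matrix.of fun u u' : U => kent x τ W u u').det := by
  have hd := Dn_ne hx W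
  unfold qW
  rw [Nm_card hx, Dn_card hx] at *
  set Q : W → Finset (List S) := fun v => (stack x v).permutations.toFinset with hQ
  set Q' : W → Finset (List S) := fun v => if (v : S) ∈ U then
      (stack x v).permutations.toFinset.filter (fun l => l = τ v) else
        (stack x v).permutations.toFinset with hQ'
  set n := ((Fintype.piFinset Q').filter (fun φ => AcF (fun v => lastW W (φ v)))).card
  set d := ((Fintype.piFinset Q).filter (fun φ => AcF (fun v => lastW W (φ v)))).card
  have hdpos : (0:ℝ) < d := by
    have : d ≠ 0 := by exact_mod_cast hd.1
    exact_mod_cast Nat.pos_of_ne_zero this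
  have e1 : (n : ℝ≥0∞) / d = ENNReal.ofReal ((n:ℝ) / d) := by
    rw [ENNReal.ofReal_div_of_pos hdpos, ENNReal.ofReal_natCast, ENNReal.ofReal_natCast]
  rw [e1]
  congr 1
  -- real computation
  set c : W → ℝ := fun v => ((Q v).card : ℝ) with hc
  have hcpos : ∀ v, 0 < c v := by
    intro v
    have : (stack x v) ∈ Q v := by simp [hQ]
    simp only [hc]
    exact_mod_cast Finset.card_pos.2 ⟨_, this⟩
  set G : Matrix W W ℝ := Matrix.of fun w u => gw x W w u with hG
  set MQ : Matrix W W ℝ := Matrix.of fun v y => ∑ k ∈ Q v, ((if v = y then (1:ℝ) else 0) -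
      (if lastW W k = some y then 1 else 0)) with hMQ
  set MQ' : Matrix W W ℝ := Matrix.of fun v y => ∑ k ∈ Q' v, ((if v = y then (1:ℝ) else 0) -
      (if lastW W k = some y then 1 else 0)) with hMQ'
  have m1 : MQ.det = (d:ℝ) := by
    rw [hMQ]
    convert mtt Q (lastW W)
  have m2 : MQ'.det = (n:ℝ) := by
    rw [hMQ']
    convert mtt Q' (lastW W)
  have hp : ∀ v y : W, MQ v y = c v * ((if v = y then 1 else 0) - (pk x v y).toReal) := by
    intro v y
    rw [hMQ, Matrix.of_apply, Finset.sum_sub_distrib, Finset.sum_const,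
      nsmul_eq_mul, mul_sub]
    congr 1
    rw [Finset.sum_boole]
    simp only [lastW_eq_some]
    have h1 := card_last (stack x v) y
    have h2 : (pk x v y).toReal = ((stack x v).count (y:S) : ℝ) / (stack x v).length := by
      simp [pk, ENNReal.toReal_div]
    rw [h2]
    by_cases h0 : (stack x v).length = 0
    · rw [List.length_eq_zero_iff] at h0
      simp [hQ, h0]
    · have h0' : ((stack x v).length : ℝ) ≠ 0 := by exact_mod_cast h0
      rw [mul_div_assoc', eq_div_iff h0']
      simp only [hc, hQ]
      exact_mod_cast h1
  have hMG : MQ * G = Matrix.diagonal c := by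
    ext v u
    rw [Matrix.mul_apply, Matrix.diagonal_apply]
    simp only [hp, hG, Matrix.of_apply]
    have := gw_eq hx W v u
    have e : ∑ y : W, c v * ((if v = y then 1 else 0) - (pk x v y).toReal) * gw x W y u =
        c v * (gw x W v u - ∑ y : W, (pk x v y).toReal * gw x W y u) := by
      simp only [mul_assoc, sub_mul, ← Finset.mul_sum, Finset.sum_sub_distrib, ite_mul, one_mul,
        zero_mul, Finset.sum_ite_eq, Finset.mem_univ, if_true]
    rw [e, this]
    split_ifs <;> simp
  set K : Matrix W W ℝ := Matrix.diagonal (fun v => (c v)⁻¹) * (MQ' * G) with hK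
  have hKdet : K.det = (n:ℝ) / d := by
    have h1 : MQ.det * G.det = ∏ v, c v := by rw [← Matrix.det_mul, hMG, Matrix.det_diagonal]
    rw [m1] at h1
    rw [hK, Matrix.det_mul, Matrix.det_mul, Matrix.det_diagonal, m2, Finset.prod_inv_distrib,
      ← h1]
    have hGne : G.det ≠ 0 := by
      intro h
      rw [h, mul_zero] at h1
      exact (Finset.prod_pos (fun v _ => hcpos v)).ne h1
    field_simp
  rw [← hKdet]
  refine block_det hUW K (kent x τ W) ?_ ?_
  · intro v y hv
    rw [hK, Matrix.diagonal_mul, Matrix.mul_apply]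
    have : ∀ j, MQ' v j = MQ v j := by
      intro j
      simp only [hMQ', hMQ, Matrix.of_apply, hQ', hQ, if_neg hv]
    simp only [this]
    rw [← Matrix.mul_apply, hMG, Matrix.diagonal_apply]
    split_ifs with h
    · exact inv_mul_cancel₀ (hcpos v).ne'
    · simp
  · intro u u' hu hu'
    rw [hK, Matrix.diagonal_mul, Matrix.mul_apply]
    have hQu : Q' u = {τ u} := by
      simp only [hQ', if_pos hu]
      ext l
      simp
      rintro rfl
      exact hτ u hu
    have : ∀ j, MQ' u j = (if u = j then (1:ℝ) else 0) -
      (if lastW W (τ u) = some j then 1 else 0) := by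
      intro j
      simp only [hMQ', Matrix.of_apply, hQu, Finset.sum_singleton]
    simp only [this, sub_mul, Finset.sum_sub_distrib, ite_mul, one_mul, zero_mul,
      Finset.sum_ite_eq, Finset.mem_univ, if_true]
    unfold kent
    simp only [hc, hQ]
    congr 2
    rcases hl : (τ u).getLast? with _ | w
    · simp [lastW, hl]
    · by_cases hw : w ∈ W
      · have : lastW W (τ u) = some ⟨w, hw⟩ := lastW_eq_some.2 hl
        simp [this, hG]
      · have : lastW W (τ u) = none := by simp [lastW, hl, hw]
        simp [this, gw_zero x hw u'.2]

lemma qW_lim {x : ℕ → S} (hx : Tr x) (U : Finset S) (τ : S → List S) :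
    ∃ a : ℝ≥0∞, Tendsto (fun W => qW U τ W x) atTop (nhds a) := by
  by_cases hτ : ∀ u ∈ U, (τ u).Perm (stack x u)
  · choose g hg using gw_lim hx
    have hk : ∀ u u', ∃ k : ℝ, Tendsto (fun W => kent x τ W u u') atTop (nhds k) := by
      intro u u'
      unfold kent
      rcases (τ u).getLast? with _ | w
      · exact ⟨_, ((hg u u').sub tendsto_const_nhds).const_mul _⟩
      · exact ⟨_, ((hg u u').sub (hg w u')).const_mul _⟩
    choose k hk using hk
    refine ⟨ENNReal.ofReal (Matrix.of fun u u' : U => k u u').det, ?_⟩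
    have h1 : Tendsto (fun W => (Matrix.of fun u u' : U => kent x τ W u u')) atTop
        (nhds (Matrix.of fun u u' : U => k u u')) := by
      refine tendsto_pi_nhds.2 fun u => tendsto_pi_nhds.2 fun u' => hk u u'
    have h2 := ENNReal.tendsto_ofReal (((Continuous.matrix_det continuous_id).tendsto _).comp h1)
    refine h2.congr' ?_
    filter_upwards [eventually_ge_atTop U] with W hW
    exact (qW_eq hx hW τ hτ).symm
  · refine ⟨0, tendsto_const_nhds.congr' ?_⟩
    filter_upwards [eventually_ge_atTop U] with W hW
    push Not at hτ
    obtain ⟨u, hu, hp⟩ := hτ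
    have : Nm U τ W x = 0 := by
      unfold Nm
      rw [ENNReal.tsum_eq_zero]
      intro t
      rw [if_neg]
      rintro ⟨a, -, c⟩
      rw [CC_iff hx] at a
      have := a ⟨u, hW hu⟩
      rw [c ⟨u, hW hu⟩ hu] at this
      exact hp this
    simp [qW, this]

end Aux6

section Aux7
open scoped Classical

lemma infEquiv_transNum {x y : ℕ → S} (h : InfEquiv x y) (u v : S) :
    transNum x u v = transNum y u v := by
  obtain ⟨N, h1, h2⟩ := h
  have key : ∀ z : ℕ → S, transNum z u v = (transCount z N u v : ℕ∞) +
      Set.encard {i : ℕ | N ≤ i ∧ z i = u ∧ z (i + 1) = v} := by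
    intro z
    unfold transNum transCount
    rw [Set.Finite.cast_ncard_eq ((Set.finite_lt_nat N).subset (fun i hi => hi.1)),
      ← Set.encard_union_eq]
    · congr 1
      ext i
      simp only [Set.mem_union, Set.mem_ofPred_eq]
      constructor
      · intro h
        rcases lt_or_ge i N with h' | h'
        · exact Or.inl ⟨h', h⟩
        · exact Or.inr ⟨h', h⟩
      · rintro (h | h) <;> exact h.2
    · rw [Set.disjoint_left]
      intro i hi hi'
      have a := hi.1
      have b := hi'.1
      omega
  rw [key x, key y, h2.2 u v]
  congr 2
  ext i
  simp only [Set.mem_ofPred_eq]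
  constructor
  · rintro ⟨a, b⟩
    rw [h1 i a, h1 (i+1) (by omega)] at b
    exact ⟨a, b⟩
  · rintro ⟨a, b⟩
    rw [← h1 i a, ← h1 (i+1) (by omega)] at b
    exact ⟨a, b⟩

lemma infEquiv_Tr {x y : ℕ → S} (h : InfEquiv x y) (hx : Tr x) : Tr y := by
  obtain ⟨N, h1, -⟩ := h
  intro v
  obtain ⟨n, hn⟩ := hx v
  exact ⟨max n N, fun i hi => by rw [← h1 i (by omega)]; exact hn i (by omega)⟩

lemma transSigma_inv {C : Set (ℕ → S)} (hC : MeasurableSet[transSigma S] C) {x y : ℕ → S}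
    (h : InfEquiv x y) (hx : x ∈ C) : y ∈ C := by
  have hle : transSigma S ≤ MeasurableSpace.comap (fun x : ℕ → S => transNum x) ⊤ := by
    refine iSup_le fun u => iSup_le fun v => ?_
    rintro _ ⟨s, -, rfl⟩
    exact ⟨{f | f u v ∈ s}, trivial, rfl⟩
  obtain ⟨D, -, rfl⟩ := hle C hC
  have : transNum x = transNum y := by
    funext u v; exact infEquiv_transNum h u v
  simp only [mem_preimage] at hx ⊢
  rw [← this]; exact hx

lemma le_transNum (x : ℕ → S) (u v : S) (k : ℕ) :
    (k : ℕ∞) ≤ transNum x u v ↔ ∃ N, k ≤ transCount x N u v := by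
  have hfin : ∀ N, {i : ℕ | i < N ∧ x i = u ∧ x (i + 1) = v}.Finite := fun N =>
    (Set.finite_lt_nat N).subset (fun i hi => hi.1)
  constructor
  · intro h
    obtain ⟨t, ht, hk⟩ := Set.exists_subset_encard_eq h
    have htf : t.Finite := Set.finite_of_encard_eq_coe hk
    obtain ⟨N, hN⟩ := htf.bddAbove
    refine ⟨N + 1, ?_⟩
    have : t ⊆ {i : ℕ | i < N + 1 ∧ x i = u ∧ x (i + 1) = v} := fun i hi =>
      ⟨by have := hN hi; omega, ht hi⟩
    have h2 := Set.encard_le_encard this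
    rw [hk, ← (hfin (N+1)).cast_ncard_eq] at h2
    exact_mod_cast h2
  · rintro ⟨N, hN⟩
    have : {i : ℕ | i < N ∧ x i = u ∧ x (i + 1) = v} ⊆ {i : ℕ | x i = u ∧ x (i + 1) = v} :=
      fun i hi => hi.2
    have h2 := Set.encard_le_encard this
    rw [← (hfin N).cast_ncard_eq] at h2
    refine le_trans ?_ h2
    exact_mod_cast hN

lemma meas_transNum_sigma (u v : S) (a : ℕ∞) :
    MeasurableSet[transSigma S] {x : ℕ → S | a = transNum x u v} := by
  have h1 : MeasurableSpace.comap (fun x => transNum x u v) (⊤ : MeasurableSpace ℕ∞)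
      ≤ transSigma S := le_iSup₂_of_le u v le_rfl
  refine h1 _ ⟨{a}, trivial, ?_⟩
  ext x
  simp [eq_comm]

section
variable [Countable S]

lemma meas_CC (W : Finset S) (t : W → List S) :
    MeasurableSet[transSigma S] {x : ℕ → S | CC W x t} := by
  letI := transSigma S
  exact mall fun v => mall fun w => meas_transNum_sigma _ _ _

lemma meas_Nm (U W : Finset S) (τ : S → List S) : Measurable[transSigma S] (Nm U τ W) := by
  letI := transSigma S
  unfold Nm
  refine Measurable.ennreal_tsum fun t => ?_
  exact Measurable.ite (mand (meas_CC W t) (mconst _)) measurable_const measurable_const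

lemma meas_Dn (W : Finset S) : Measurable[transSigma S] (Dn W) := by
  letI := transSigma S
  unfold Dn
  refine Measurable.ennreal_tsum fun t => ?_
  exact Measurable.ite (mand (meas_CC W t) (mconst _)) measurable_const measurable_const

lemma meas_qW (U W : Finset S) (τ : S → List S) : Measurable[transSigma S] (qW U τ W) := by
  letI := transSigma S
  exact (meas_Nm U W τ).div (meas_Dn W)
end

lemma qW_le_one (U W : Finset S) (τ : S → List S) (x : ℕ → S) : qW U τ W x ≤ 1 := by
  unfold qW
  refine ENNReal.div_le_of_le_mul ?_
  rw [one_mul]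
  unfold Nm Dn
  refine ENNReal.tsum_le_tsum fun t => ?_
  split_ifs with h1 h2
  · exact le_rfl
  · exact absurd ⟨h1.1, h1.2.1⟩ h2
  · simp
  · simp

variable [Countable S] [MeasurableSpace S] [DiscreteMeasurableSpace S]

lemma transSigma_le : transSigma S ≤ (inferInstance : MeasurableSpace (ℕ → S)) := by
  refine iSup_le fun u => iSup_le fun v => ?_
  have hk : ∀ k : ℕ, MeasurableSet {x : ℕ → S | (k : ℕ∞) ≤ transNum x u v} := by
    intro k
    simp only [le_transNum]
    refine mex fun N => meas_of_init N _ (fun x y h hx => ?_)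
    simp only [Set.mem_ofPred_eq, transCount_eq] at hx ⊢
    rw [← stk_congr h]; exact hx
  have ha : ∀ a : ℕ∞, MeasurableSet {x : ℕ → S | transNum x u v = a} := by
    intro a
    induction a using ENat.recTopCoe with
    | top =>
      have : {x : ℕ → S | transNum x u v = ⊤} = {x | ∀ k : ℕ, (k : ℕ∞) ≤ transNum x u v} := by
        ext x
        simp only [Set.mem_ofPred_eq]
        exact ENat.eq_top_iff_forall_ge
      rw [this]
      exact mall hk
    | coe k =>
      have : {x : ℕ → S | transNum x u v = k} =
          {x | (k : ℕ∞) ≤ transNum x u v ∧ ¬ ((k+1 : ℕ) : ℕ∞) ≤ transNum x u v} := by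
        ext x
        simp only [Set.mem_ofPred_eq]
        generalize transNum x u v = b
        induction b using ENat.recTopCoe with
        | top => simp
        | coe b =>
          norm_cast
          omega
      rw [this]
      exact mand (hk k) (mnot (hk (k+1)))
  rintro _ ⟨s, -, rfl⟩
  have : (fun x : ℕ → S => transNum x u v) ⁻¹' s = {x | ∃ a : s, transNum x u v = a} := by
    ext x
    simp
  rw [this]
  exact mex fun a => ha a

/-- the event that the stacks on `U` are given by `τ` -/
def ZZ (U : Finset S) (τ : S → List S) : Set (ℕ → S) := {x | ∀ u ∈ U, stack x u = τ u}

lemma meas_ZZ (U : Finset S) (τ : S → List S) : MeasurableSet (ZZ U τ) :=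
  mall fun _ => mimp (mconst _) (meas_stack_eq _ _)

lemma ident_W (μ : Measure (ℕ → S)) [IsFiniteMeasure μ] (hPE : PartiallyExchangeable μ)
    {A : Set (ℕ → S)} (hAm : MeasurableSet A) (hATr : ∀ x ∈ A, Tr x)
    (hA : ∀ x ∈ A, ∀ y : ℕ → S, InfEquiv x y → y ∈ A) (B W U : Finset S) (hUW : U ⊆ W)
    (τ : S → List S) :
    μ (A ∩ {x | HB B W x} ∩ ZZ U τ) = ∫⁻ x in A ∩ {x | HB B W x}, qW U τ W x ∂μ := by
  set a : (W → List S) → ℝ≥0∞ := fun t => μ (FV A B W t) with ha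
  set G : (W → List S) → Prop := fun t => ∀ v : W, (v : S) ∈ U → t v = τ v with hG
  set R : (W → List S) → (W → List S) → Prop := fun t t' => ∀ v, (t' v).Perm (t v) with hR
  set d : (W → List S) → ℝ≥0∞ := fun t => ∑' t', if R t t' ∧ Acyc t' then 1 else 0 with hd
  set n : (W → List S) → ℝ≥0∞ := fun t => ∑' t', if R t t' ∧ Acyc t' ∧ G t' then 1 else 0 with hn
  have hRs : ∀ t t', R t t' → R t' t := fun t t' h v => (h v).symm
  have hRt : ∀ t t' t'', R t t' → R t' t'' → R t t'' := fun t t' t'' h h' v => (h' v).trans (h v)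
  have hunion : A ∩ {x | HB B W x} = ⋃ t, FV A B W t := by
    ext x
    simp only [mem_iUnion]
    constructor
    · rintro ⟨h1, h2⟩
      exact ⟨fun v => stack x v, h1, h2, fun v => rfl⟩
    · rintro ⟨t, h1, h2, _⟩
      exact ⟨h1, h2⟩
  have hdisj : Pairwise (Function.onFun Disjoint (FV A B W)) := by
    intro t t' htt
    rw [Function.onFun, Set.disjoint_left]
    rintro x ⟨_, _, h⟩ ⟨_, _, h'⟩
    exact htt (funext fun v => (h v).symm.trans (h' v))
  have hq : ∀ t, ∀ x ∈ FV A B W t, qW U τ W x = n t / d t := by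
    rintro t x ⟨h1, h2, h3⟩
    have hx := hATr x h1
    have hcc : ∀ t', CC W x t' ↔ R t t' := by
      intro t'
      rw [CC_iff hx]
      simp only [h3, hR]
    unfold qW Nm Dn
    simp only [hcc, hn, hd, hG]
  have hnac : ∀ t, ¬ Acyc t → a t = 0 := by
    intro t ht
    have : FV A B W t = ∅ := by
      refine Set.eq_empty_of_forall_notMem ?_
      rintro x ⟨h1, h2, h3⟩
      refine ht ?_
      have := acyc_stack (hATr x h1) W
      simpa only [h3] using this
    simp only [ha, this, measure_empty]
  have hsym : ∀ t t', R t t' → Acyc t → Acyc t' → a t = a t' := by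
    intro t t' h h1 h2
    exact le_antisymm (swap_le μ hPE hATr hA B W t t' h h2)
      (swap_le μ hPE hATr hA B W t' t (hRs _ _ h) h1)
  have hdsym : ∀ t t', R t t' → d t = d t' := by
    intro t t' h
    simp only [hd]
    refine tsum_congr fun s => ?_
    have : R t s ↔ R t' s := ⟨fun h' => hRt _ _ _ (hRs _ _ h) h', fun h' => hRt _ _ _ h h'⟩
    simp only [this]
  have hdn : ∀ t, a t ≠ 0 → d t ≠ 0 ∧ d t ≠ ⊤ := by
    intro t ht
    obtain ⟨x, h1, h2, h3⟩ := nonempty_of_measure_ne_zero ht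
    have hx := hATr x h1
    have : d t = Dn W x := by
      unfold Dn
      simp only [hd]
      refine tsum_congr fun s => ?_
      have : CC W x s ↔ R t s := by
        rw [CC_iff hx]
        simp only [h3, hR]
      simp only [this]
    rw [this]
    exact Dn_ne hx W
  have hmeasH : MeasurableSet (A ∩ {x | HB B W x}) := hAm.inter (meas_HB B W)
  calc μ (A ∩ {x | HB B W x} ∩ ZZ U τ)
      = ∑' t, μ (FV A B W t ∩ ZZ U τ) := by
        rw [hunion, Set.iUnion_inter, measure_iUnion]
        · intro t t' htt
          exact (hdisj htt).mono inter_subset_left inter_subset_left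
        · intro t
          exact (meas_FV hAm B W t).inter (meas_ZZ U τ)
    _ = ∑' t, if G t then a t else 0 := by
        refine tsum_congr fun t => ?_
        split_ifs with h
        · simp only [ha]
          congr 1
          refine Set.inter_eq_left.2 ?_
          rintro x ⟨_, _, h3⟩ u hu
          rw [h3 ⟨u, hUW hu⟩, h ⟨u, hUW hu⟩ hu]
        · have : FV A B W t ∩ ZZ U τ = ∅ := by
            refine Set.eq_empty_of_forall_notMem ?_
            rintro x ⟨⟨_, _, h3⟩, hz⟩
            refine h fun v hv => ?_
            rw [← h3 v]; exact hz v hv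
          rw [this, measure_empty]
    _ = ∑' t', ∑' t, (if R t t' ∧ Acyc t' ∧ G t' then a t / d t else 0) := by
        refine tsum_congr fun t' => ?_
        by_cases hac : Acyc t'
        · have e1 : ∀ t, (if R t t' ∧ Acyc t' ∧ G t' then a t / d t else 0) =
              (if G t' then a t' / d t' else 0) * (if R t' t ∧ Acyc t then 1 else 0) := by
            intro t
            by_cases hG' : G t'
            · by_cases hr : R t t'
              · by_cases hac' : Acyc t
                · rw [if_pos ⟨hr, hac, hG'⟩, if_pos hG', if_pos ⟨hRs _ _ hr, hac'⟩, mul_one,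
                    hsym t t' hr hac' hac, hdsym t t' hr]
                · rw [if_pos ⟨hr, hac, hG'⟩, hnac t hac', if_pos hG',
                    if_neg (c := R t' t ∧ Acyc t) (fun h => hac' h.2)]
                  simp
              · rw [if_neg (fun h => hr h.1), if_neg (c := R t' t ∧ Acyc t)
                  (fun h => hr (hRs _ _ h.1))]
                simp
            · rw [if_neg (fun h => hG' h.2.2), if_neg hG']
              simp
          rw [tsum_congr e1, ENNReal.tsum_mul_left]
          change _ = _ * d t'
          split_ifs with h
          · by_cases h0 : a t' = 0
            · rw [h0]; simp
            · have := hdn t' h0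
              rw [ENNReal.div_mul_cancel this.1 this.2]
          · simp
        · have : a t' = 0 := hnac t' hac
          simp [this, hac]
    _ = ∑' t, ∑' t', (if R t t' ∧ Acyc t' ∧ G t' then a t / d t else 0) := ENNReal.tsum_comm
    _ = ∑' t, n t / d t * a t := by
        refine tsum_congr fun t => ?_
        have e1 : ∀ t', (if R t t' ∧ Acyc t' ∧ G t' then a t / d t else 0) =
            (a t / d t) * (if R t t' ∧ Acyc t' ∧ G t' then 1 else 0) := by
          intro t'
          split_ifs <;> simp
        rw [tsum_congr e1, ENNReal.tsum_mul_left]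
        change a t / d t * n t = _
        rw [ENNReal.div_eq_inv_mul, ENNReal.div_eq_inv_mul]
        ring
    _ = ∑' t, ∫⁻ x in FV A B W t, qW U τ W x ∂μ := by
        refine tsum_congr fun t => ?_
        rw [setLIntegral_congr_fun (meas_FV hAm B W t) (fun x hx => hq t x hx), setLIntegral_const]
    _ = ∫⁻ x in A ∩ {x | HB B W x}, qW U τ W x ∂μ := by
        rw [hunion, lintegral_iUnion (fun t => meas_FV hAm B W t) hdisj]

end Aux7

section Aux8
open scoped Classical

/-- the starting point and the stacks on the sites of a path determine whether it is followed -/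
lemma cyl_of_stack {x y : ℕ → S} (hx : Tr x) (hy : Tr y) {n : ℕ} {c : ℕ → S}
    (hxc : x ∈ cyl n c) (h0 : y 0 = x 0)
    (h : ∀ i ≤ n, stack y (c i) = stack x (c i)) : y ∈ cyl n c := by
  have key : ∀ m ≤ n, ∀ i ≤ m, y i = x i := by
    intro m
    induction m with
    | zero =>
      intro _ i hi
      obtain rfl : i = 0 := by omega
      exact h0
    | succ m ih =>
      intro hm i hi
      have ih := ih (by omega)
      rcases Nat.lt_or_ge i (m + 1) with h' | h'
      · exact ih i (by omega)
      · obtain rfl : i = m + 1 := by omega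
        have e1 := stk_prefix_stack hx (m + 1) (x m)
        have e2 := stk_prefix_stack hy (m + 1) (x m)
        have e3 : stack y (x m) = stack x (x m) := by
          rw [hxc m (by omega)]; exact h m (by omega)
        rw [stk_succ, if_pos rfl] at e1
        rw [stk_succ, if_pos (ih m le_rfl), stk_congr ih, e3] at e2
        have := (List.prefix_of_prefix_length_le e2 e1 (by simp)).eq_of_length (by simp)
        simpa using this
  intro i hi
  rw [key n le_rfl i hi]
  exact hxc i hi

variable [Countable S] [MeasurableSpace S] [DiscreteMeasurableSpace S]

lemma exists_q (μ : Measure (ℕ → S)) [IsFiniteMeasure μ] (hPE : PartiallyExchangeable μ)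
    (U : Finset S) (τ : S → List S) :
    ∃ q : (ℕ → S) → ℝ≥0∞, Measurable[transSigma S] q ∧
      ∀ A : Set (ℕ → S), MeasurableSet A → (∀ x ∈ A, Tr x) →
        (∀ x ∈ A, ∀ y : ℕ → S, InfEquiv x y → y ∈ A) →
        μ (A ∩ ZZ U τ) = ∫⁻ x in A, q x ∂μ := by
  obtain ⟨B, hB⟩ := exists_seq_tendsto (atTop : Filter (Finset S))
  refine ⟨fun x => limsup (fun k => qW U τ (B k) x) atTop, ?_, ?_⟩
  · letI := transSigma S
    exact Measurable.limsup (fun k => meas_qW U (B k) τ)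
  intro A hAm hATr hA
  choose w hw using fun k x => HB_exists (B k) (x : ℕ → S)
  have hwm : ∀ k W, MeasurableSet {x | w k x = W} := by
    intro k W
    have : {x | w k x = W} = {x | HB (B k) W x} := by
      ext x
      exact ⟨fun h => h ▸ hw k x, fun h => HB_unique (hw k x) h⟩
    rw [this]
    exact meas_HB _ _
  have hwmeas : ∀ k, @Measurable _ _ _ ⊤ (w k) := by
    intro k
    letI : MeasurableSpace (Finset S) := ⊤
    exact measurable_to_countable' (fun W => hwm k W)
  have hlim : ∀ x, Tr x → Tendsto (fun k => w k x) atTop atTop := by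
    intro x hx
    refine tendsto_atTop.2 fun V => ?_
    obtain ⟨W, h1, h2⟩ := PC_superset hx V
    filter_upwards [hB.eventually (eventually_ge_atTop W)] with k hk
    exact h1.trans ((hw k x).2.2 W hk h2)
  set f : ℕ → (ℕ → S) → ℝ≥0∞ := fun k x => if U ⊆ w k x then qW U τ (w k x) x else 0 with hf
  set g : ℕ → (ℕ → S) → ℝ≥0∞ := fun k x => if U ⊆ w k x then (ZZ U τ).indicator 1 x else 0 with hg
  have hfm : ∀ k, Measurable (f k) := by
    intro k
    letI : MeasurableSpace (Finset S) := ⊤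
    have h2 : Measurable (fun p : Finset S × (ℕ → S) =>
        if U ⊆ p.1 then qW U τ p.1 p.2 else 0) := by
      refine measurable_from_prod_countable_right fun W => ?_
      by_cases h : U ⊆ W
      · simp only [h, if_true]
        exact (meas_qW U W τ).mono transSigma_le le_rfl
      · simp only [h, if_false]
        exact measurable_const
    exact h2.comp ((hwmeas k).prodMk measurable_id)
  have hgm : ∀ k, Measurable (g k) := by
    intro k
    letI : MeasurableSpace (Finset S) := ⊤
    have h2 : MeasurableSet {x | U ⊆ w k x} := hwmeas k (t := {W | U ⊆ W}) trivial
    exact Measurable.ite h2 (measurable_one.indicator (meas_ZZ U τ)) measurable_const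
  have hunion : ∀ k, A = ⋃ W, A ∩ {x | HB (B k) W x} := by
    intro k
    ext x
    simp only [Set.mem_iUnion, Set.mem_inter_iff]
    exact ⟨fun h => ⟨w k x, h, hw k x⟩, fun ⟨_, h, _⟩ => h⟩
  have hdisj : ∀ k, Pairwise (Function.onFun Disjoint fun W => A ∩ {x | HB (B k) W x}) := by
    intro k W W' hne
    refine Set.disjoint_left.2 fun x h h' => hne (HB_unique h.2 h'.2)
  have hmE : ∀ k W, MeasurableSet (A ∩ {x | HB (B k) W x}) := fun k W => hAm.inter (meas_HB _ _)
  have hfg : ∀ k, ∫⁻ x in A, f k x ∂μ = ∫⁻ x in A, g k x ∂μ := by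
    intro k
    rw [hunion k, lintegral_iUnion (hmE k) (hdisj k), lintegral_iUnion (hmE k) (hdisj k)]
    refine tsum_congr fun W => ?_
    have e : ∀ x ∈ A ∩ {x | HB (B k) W x}, w k x = W := fun x hx => HB_unique (hw k x) hx.2
    by_cases h : U ⊆ W
    · rw [setLIntegral_congr_fun (g := qW U τ W) (hmE k W),
        setLIntegral_congr_fun (f := g k) (g := (ZZ U τ).indicator 1) (hmE k W),
        ← ident_W μ hPE hAm hATr hA (B k) W U h τ, lintegral_indicator_one (meas_ZZ U τ),
        Measure.restrict_apply (meas_ZZ U τ), Set.inter_comm]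
      · intro x hx
        simp only [hg, e x hx, h, if_true]
      · intro x hx
        simp only [hf, e x hx, h, if_true]
    · rw [setLIntegral_congr_fun (f := f k) (g := g k) (hmE k W)]
      intro x hx
      simp only [hf, hg, e x hx, h, if_false]
  have hTrA : ∀ᵐ x ∂(μ.restrict A), Tr x :=
    (ae_restrict_iff' hAm).2 (Eventually.of_forall hATr)
  have l1 : Tendsto (fun k => ∫⁻ x in A, f k x ∂μ) atTop
      (nhds (∫⁻ x in A, limsup (fun k => qW U τ (B k) x) atTop ∂μ)) := by
    refine tendsto_lintegral_of_dominated_convergence (fun _ => 1) hfm ?_ ?_ ?_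
    · intro k
      refine Eventually.of_forall fun x => ?_
      simp only [hf]
      split_ifs
      · exact qW_le_one _ _ _ _
      · exact zero_le_one
    · simp
    · filter_upwards [hTrA] with x hx
      obtain ⟨a, ha⟩ := qW_lim (U := U) (τ := τ) hx
      have h1 : Tendsto (fun k => qW U τ (B k) x) atTop (nhds a) := ha.comp hB
      have h2 : Tendsto (fun k => qW U τ (w k x) x) atTop (nhds a) := ha.comp (hlim x hx)
      rw [h1.limsup_eq]
      refine h2.congr' ?_
      filter_upwards [(hlim x hx).eventually (eventually_ge_atTop U)] with k hk
      exact (if_pos hk).symm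
  have l2 : Tendsto (fun k => ∫⁻ x in A, g k x ∂μ) atTop
      (nhds (∫⁻ x in A, (ZZ U τ).indicator 1 x ∂μ)) := by
    refine tendsto_lintegral_of_dominated_convergence (fun _ => 1) hgm ?_ ?_ ?_
    · intro k
      refine Eventually.of_forall fun x => ?_
      simp only [hg]
      split_ifs
      · exact Set.indicator_le_self' (fun _ _ => zero_le_one) x
      · exact zero_le_one
    · simp
    · filter_upwards [hTrA] with x hx
      refine tendsto_const_nhds.congr' ?_
      filter_upwards [(hlim x hx).eventually (eventually_ge_atTop U)] with k hk
      exact (if_pos hk).symm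
  simp only [hfg] at l1
  have := tendsto_nhds_unique l2 l1
  rw [← this, lintegral_indicator_one (meas_ZZ U τ), Measure.restrict_apply (meas_ZZ U τ),
    Set.inter_comm]

/-- there is a density measurable with respect to the transition numbers -/
lemma exists_h (μ : Measure (ℕ → S)) [IsFiniteMeasure μ] (hPE : PartiallyExchangeable μ)
    (hTr : ∀ᵐ x ∂μ, Tr x)
    (A : Set (ℕ → S)) (hAm : MeasurableSet A) (hATr : ∀ x ∈ A, Tr x)
    (hA : ∀ x ∈ A, ∀ y : ℕ → S, InfEquiv x y → y ∈ A) :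
    ∃ h : (ℕ → S) → ℝ≥0∞, Measurable[transSigma S] h ∧ μ A = ∫⁻ x, h x ∂μ ∧
      ∀ U τ, μ (A ∩ ZZ U τ) = ∫⁻ x in ZZ U τ, h x ∂μ := by
  have hm : transSigma S ≤ (inferInstance : MeasurableSpace (ℕ → S)) := transSigma_le
  set ν := μ.trim hm with hν
  set ρ := (μ.restrict A).trim hm with hρ
  have hac : ρ ≪ ν := by
    refine Measure.AbsolutelyContinuous.mk fun s hs h0 => ?_
    rw [hρ, trim_measurableSet_eq hm hs]
    rw [hν, trim_measurableSet_eq hm hs] at h0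
    exact le_antisymm ((Measure.restrict_apply_le _ _).trans h0.le) bot_le
  have hρd : ν.withDensity (ρ.rnDeriv ν) = ρ := Measure.withDensity_rnDeriv_eq _ _ hac
  have hhm : Measurable[transSigma S] (ρ.rnDeriv ν) := Measure.measurable_rnDeriv _ _
  set h := ρ.rnDeriv ν with hh
  have hdens : ∀ g : (ℕ → S) → ℝ≥0∞, Measurable[transSigma S] g →
      ∫⁻ x in A, g x ∂μ = ∫⁻ x, h x * g x ∂μ := by
    intro g hg
    rw [← lintegral_trim hm hg, ← hρ, ← hρd, lintegral_withDensity_eq_lintegral_mul _ hhm hg,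
      hν, lintegral_trim hm (hhm.mul hg)]
    rfl
  refine ⟨h, hhm, ?_, fun U τ => ?_⟩
  · have := hdens (fun _ => 1) measurable_const
    simpa using this
  obtain ⟨q, hq, hqA⟩ := exists_q μ hPE U τ
  rw [hqA A hAm hATr hA, hdens q hq]
  have e : (μ.restrict (ZZ U τ)).trim hm = ν.withDensity q := by
    refine @Measure.ext _ (transSigma S) _ _ fun C hC => ?_
    rw [trim_measurableSet_eq hm hC, withDensity_apply _ hC, Measure.restrict_apply (hm C hC),
      hν, restrict_trim hm _ hC, lintegral_trim hm hq]
    have hae : (C ∩ {x | Tr x} : Set (ℕ → S)) =ᵐ[μ] C := by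
      filter_upwards [hTr] with x hx
      exact propext ⟨fun h => h.1, fun h => ⟨h, hx⟩⟩
    rw [← setLIntegral_congr hae, ← hqA (C ∩ {x | Tr x}) ((hm C hC).inter meas_Tr)
      (fun x hx => hx.2)
      (fun x hx y hxy => ⟨transSigma_inv hC hxy hx.1, infEquiv_Tr hxy hx.2⟩)]
    exact (measure_congr (hae.inter (ae_eq_refl _))).symm
  rw [← lintegral_trim hm (hhm), e, lintegral_withDensity_eq_lintegral_mul _ hq hhm,
    hν, lintegral_trim hm (hq.mul hhm)]
  refine lintegral_congr fun x => ?_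
  simp [mul_comm]

lemma agree (μ : Measure (ℕ → S)) [IsFiniteMeasure μ]
    (hTr : ∀ᵐ x ∂μ, Tr x) (s0 : S) (h0 : ∀ᵐ x ∂μ, x 0 = s0)
    (A : Set (ℕ → S)) (hAm : MeasurableSet A) (h : (ℕ → S) → ℝ≥0∞)
    (hu : μ A = ∫⁻ x, h x ∂μ)
    (hZ : ∀ U τ, μ (A ∩ ZZ U τ) = ∫⁻ x in ZZ U τ, h x ∂μ) :
    μ.restrict A = μ.withDensity h := by
  refine ext_of_generate_finite _ (gen_cyl 0) (pi_cyl 0) ?_ ?_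
  · rintro _ ⟨n, -, c, rfl⟩
    rw [Measure.restrict_apply (meas_cyl n c), withDensity_apply _ (meas_cyl n c)]
    by_cases hc : ∃ x, x ∈ cyl n c ∧ Tr x ∧ x 0 = s0
    swap
    · have hz : μ (cyl n c) = 0 := by
        have : ∀ᵐ x ∂μ, x ∉ cyl n c := by
          filter_upwards [hTr, h0] with x h1 h2 h3
          exact hc ⟨x, h3, h1, h2⟩
        simpa [ae_iff] using this
      rw [measure_mono_null inter_subset_left hz, setLIntegral_measure_zero _ _ hz]
    set U : Finset S := (Finset.range (n + 1)).image c with hU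
    have hcU : ∀ i ≤ n, c i ∈ U := fun i hi =>
      Finset.mem_image.2 ⟨i, Finset.mem_range.2 (by omega), rfl⟩
    let ext : (U → List S) → S → List S := fun t v => if hv : v ∈ U then t ⟨v, hv⟩ else []
    have hext : ∀ t (u : U), ext t u = t u := by
      intro t u
      simp [ext]
    set T : Set (U → List S) := {t | ∃ x ∈ cyl n c, Tr x ∧ x 0 = s0 ∧ x ∈ ZZ U (ext t)} with hT
    have hae : cyl n c =ᵐ[μ] (⋃ t : T, ZZ U (ext t) : Set (ℕ → S)) := by
      filter_upwards [hTr, h0] with x h1 h2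
      refine propext ⟨fun h3 => ?_, fun h3 => ?_⟩
      · have hxz : x ∈ ZZ U (ext (fun u => stack x u)) := by
          intro u hu
          exact (hext (fun u => stack x u) ⟨u, hu⟩).symm
        exact Set.mem_iUnion.2 ⟨⟨fun u => stack x u, x, h3, h1, h2, hxz⟩, hxz⟩
      · obtain ⟨⟨t, y, hy1, hy2, hy3, hy4⟩, hx⟩ := Set.mem_iUnion.1 h3
        exact cyl_of_stack hy2 h1 hy1 (h2.trans hy3.symm) (fun i hi => by
          rw [hx _ (hcU i hi), hy4 _ (hcU i hi)])
    have hdisj : Pairwise (Function.onFun Disjoint fun t : T => ZZ U (ext t)) := by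
      intro t t' hne
      refine Set.disjoint_left.2 fun x hx hx' => hne (Subtype.ext (funext fun u => ?_))
      rw [← hext t.1 u, ← hext t'.1 u, ← hx u u.2, ← hx' u u.2]
    rw [setLIntegral_congr hae, lintegral_iUnion (fun t => meas_ZZ _ _) hdisj,
      measure_congr (hae.inter (ae_eq_refl A)), Set.iUnion_inter, measure_iUnion]
    · refine tsum_congr fun t => ?_
      rw [← hZ, Set.inter_comm]
    · intro t t' hne
      exact (hdisj hne).mono inter_subset_left inter_subset_left
    · exact fun t => (meas_ZZ _ _).inter hAm
  · rw [Measure.restrict_apply_univ, hu, withDensity_apply _ MeasurableSet.univ,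
      Measure.restrict_univ]

end Aux8

/-- For a transient partially exchangeable process with non-random initial
state, the partially exchangeable sigma-algebra is generated up to null sets by the transition
numbers: every partially exchangeable Borel set agrees, up to a `μ`-null set, with a set
measurable with respect to the sigma-algebra generated by the transition numbers. -/
theorem stmt0 {S : Type} [Countable S] [MeasurableSpace S] [DiscreteMeasurableSpace S]
    (μ : Measure (ℕ → S)) (hprob : μ Set.univ = 1)
    (hPE : PartiallyExchangeable μ)
    (htrans : μ {x | ∀ s : S, {i : ℕ | x i = s}.Finite} = 1)
    (s0 : S) (h0 : μ {x | x 0 = s0} = 1)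
    (A : Set (ℕ → S)) (hA : MeasurableSet A)
    (hPEA : ∀ x ∈ A, ∀ y : ℕ → S, InfEquiv x y → y ∈ A) :
    ∃ B : Set (ℕ → S), MeasurableSet[transSigma S] B ∧ μ (symmDiff A B) = 0 := by
  haveI : IsProbabilityMeasure μ := ⟨hprob⟩
  have hset : {x : ℕ → S | Tr x} = {x | ∀ s : S, {i : ℕ | x i = s}.Finite} := by
    ext x
    exact Tr_iff x
  have hTr : ∀ᵐ x ∂μ, Tr x := by
    rw [← hset] at htrans
    have := (prob_compl_eq_zero_iff (meas_Tr (S := S))).2 htrans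
    exact this
  have h0' : ∀ᵐ x ∂μ, x 0 = s0 := by
    have hm0 : MeasurableSet {x : ℕ → S | x 0 = s0} :=
      (measurable_pi_apply (0 : ℕ) : Measurable fun x : ℕ → S => x 0)
        (MeasurableSet.of_discrete (s := ({s0} : Set S)))
    exact (prob_compl_eq_zero_iff hm0).2 h0
  set A' := A ∩ {x | Tr x} with hA'
  have hAm : MeasurableSet A' := hA.inter meas_Tr
  obtain ⟨h, hh, hu, hZ⟩ := exists_h μ hPE hTr A' hAm (fun x hx => hx.2)
    (fun x hx y hxy => ⟨hPEA x hx.1 y hxy, infEquiv_Tr hxy hx.2⟩)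
  have heq := agree μ hTr s0 h0' A' hAm h hu hZ
  have hB : MeasurableSet[transSigma S] {x | h x = 0} :=
    hh (measurableSet_singleton (0 : ℝ≥0∞))
  refine ⟨{x | h x = 0}ᶜ, hB.compl, ?_⟩
  have hB' := transSigma_le _ hB
  have hhm : Measurable h := hh.mono transSigma_le le_rfl
  have e1 : μ ({x | h x = 0} ∩ A') = 0 := by
    rw [← Measure.restrict_apply hB', heq, withDensity_apply _ hB',
      setLIntegral_congr_fun (g := fun _ => 0) hB' (fun x hx => hx)]
    simp
  have e2 : ∀ᵐ x ∂(μ.restrict A'ᶜ), h x = 0 := by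
    have h1 : (μ.withDensity h) A'ᶜ = 0 := by
      rw [← heq, Measure.restrict_apply hAm.compl, Set.compl_inter_self, measure_empty]
    rw [withDensity_apply _ hAm.compl, lintegral_eq_zero_iff hhm] at h1
    exact h1
  rw [ae_restrict_iff' hAm.compl] at e2
  have e1' : ∀ᵐ x ∂μ, x ∉ {x | h x = 0} ∩ A' := measure_eq_zero_iff_ae_notMem.1 e1
  refine measure_eq_zero_iff_ae_notMem.2 ?_
  filter_upwards [e1', e2, hTr] with x h1 h2 h3
  rintro (⟨ha, hb⟩ | ⟨ha, hb⟩)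
  · exact h1 ⟨not_not.1 hb, ha, h3⟩
  · exact ha (h2 (fun h => hb h.1))

end DF
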